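/- arXiv:2305.05409 — 2 statements merged into one kernel-verified Lean document; each statement's English description precedes it below -/
import Mathlib

section
/- Let h : ℂ → ℝ be a smooth (C^∞) function, E_h := { z ∈ ℂ : h(z) = 0 }, and let E*_h := { z ∈ ℂ : h(z) = 0, dh(z) ≠ 0 } be the regular part of E_h. Then every totally real C²-smooth disc contained in E*_h × ℂ ⊂ ℂ² is polynomially convex. -/
noncomputable section

/-- The polynomial (convex) hull of a set `K ⊆ ℂⁿ`:
`K̂ = { z : |p(z)| ≤ sup_K |p| for every holomorphic polynomial p }`. -/
def polyHull (n : ℕ) (K : Set (Fin n → ℂ)) : Set (Fin n → ℂ) :=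
  {z | ∀ p : MvPolynomial (Fin n) ℂ,
    ‖MvPolynomial.eval z p‖ ≤ sSup ((fun w => ‖MvPolynomial.eval w p‖) '' K)}

/-- A set `K ⊆ ℂⁿ` is polynomially convex if it equals its polynomial hull. -/
def PolyConvex (n : ℕ) (K : Set (Fin n → ℂ)) : Prop := polyHull n K = K

/-- A Runge domain in `ℂⁿ`: a domain on which every holomorphic function can be
approximated uniformly on compact subsets by holomorphic polynomials. -/
def RungeDomain (n : ℕ) (Ω : Set (Fin n → ℂ)) : Prop :=
  IsOpen Ω ∧ IsConnected Ω ∧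
  ∀ f : (Fin n → ℂ) → ℂ, DifferentiableOn ℂ f Ω →
    ∀ K : Set (Fin n → ℂ), K ⊆ Ω → IsCompact K → ∀ ε : ℝ, 0 < ε →
      ∃ p : MvPolynomial (Fin n) ℂ, ∀ z ∈ K, ‖f z - MvPolynomial.eval z p‖ ≤ ε

/-- `K ⊆ ℂⁿ` is a totally real `C²`-smooth disc: the image of the closed unit
disc in `ℝ²` under a `C²` embedding `φ` (defined on an open neighborhood `U` of
the closed disc) whose image is a totally real submanifold, i.e. at each point
the tangent plane `W = range (dφ)` satisfies `W ∩ i·W = {0}`. -/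
def TotallyRealDisc (n : ℕ) (K : Set (Fin n → ℂ)) : Prop :=
  ∃ (U : Set (ℝ × ℝ)) (φ : ℝ × ℝ → (Fin n → ℂ)),
    IsOpen U ∧ Metric.closedBall (0 : ℝ × ℝ) 1 ⊆ U ∧
    ContDiffOn ℝ 2 φ U ∧ Set.InjOn φ U ∧
    (∀ x ∈ U, Function.Injective (fderiv ℝ φ x)) ∧
    (∀ x ∈ U, ∀ v w : ℝ × ℝ,
      fderiv ℝ φ x v = Complex.I • fderiv ℝ φ x w → fderiv ℝ φ x v = 0) ∧
    K = φ '' Metric.closedBall (0 : ℝ × ℝ) 1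

namespace DiscConvex

open Set Filter Topology

/-- `F` is invertible on `K` modulo the algebra `A`, up to a uniform error `1 / 2`. -/
def InvOn {E : Type*} (A : Subalgebra ℂ (E → ℂ)) (K : Set E) (F : E → ℂ) : Prop :=
  ∃ R ∈ A, ∀ x ∈ K, ‖F x * R x - 1‖ < 1 / 2

theorem InvOn.exists_pow {E : Type*} {A : Subalgebra ℂ (E → ℂ)} {K : Set E} {F : E → ℂ}
    (hF : F ∈ A) (h : InvOn A K F) (k : ℕ) :
    ∃ R ∈ A, ∀ x ∈ K, ‖F x * R x - 1‖ ≤ (1 / 2) ^ (k + 1) := by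
  obtain ⟨R, hR, hb⟩ := h
  induction k with
  | zero => exact ⟨R, hR, fun x hx => by simpa using (hb x hx).le⟩
  | succ k ih =>
    obtain ⟨S, hS, hSb⟩ := ih
    refine ⟨S + R - F * R * S, sub_mem (add_mem hS hR) (mul_mem (mul_mem hF hR) hS), fun x hx => ?_⟩
    have h1 : F x * (S + R - F * R * S) x - 1 = -((F x * S x - 1) * (F x * R x - 1)) := by
      simp only [Pi.add_apply, Pi.sub_apply, Pi.mul_apply]; ring
    rw [h1, norm_neg, norm_mul, pow_succ]
    exact mul_le_mul (hSb x hx) (hb x hx).le (norm_nonneg _) (by positivity)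

theorem InvOn.ne_zero {E : Type*} {A : Subalgebra ℂ (E → ℂ)} {K : Set E} {F : E → ℂ}
    (h : InvOn A K F) {x : E} (hx : x ∈ K) : F x ≠ 0 := by
  obtain ⟨R, -, hb⟩ := h
  intro h0
  have := hb x hx
  rw [h0] at this
  norm_num at this

/-- A small perturbation of an invertible function is invertible. -/
theorem InvOn.of_close {E : Type*} {A : Subalgebra ℂ (E → ℂ)} {K : Set E} {F G : E → ℂ} {m : ℝ}
    (hF : F ∈ A) (h : InvOn A K F) (hlow : ∀ x ∈ K, m ≤ ‖F x‖)
    (hFG : ∀ x ∈ K, ‖G x - F x‖ ≤ m / 8) : InvOn A K G := by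
  obtain ⟨R, hR, hb⟩ := h.exists_pow hF 1
  refine ⟨R, hR, fun x hx => ?_⟩
  have h1 := hb x hx
  have h2 := hlow x hx
  have h3 := hFG x hx
  have h4 : ‖F x‖ * ‖R x‖ ≤ 5 / 4 := by
    rw [← norm_mul]
    calc ‖F x * R x‖ = ‖(F x * R x - 1) + 1‖ := by ring_nf
      _ ≤ ‖F x * R x - 1‖ + ‖(1 : ℂ)‖ := norm_add_le _ _
      _ ≤ 5 / 4 := by rw [norm_one]; norm_num at h1; linarith
  have h5 : m * ‖R x‖ ≤ 5 / 4 := (mul_le_mul_of_nonneg_right h2 (norm_nonneg _)).trans h4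
  have h6 : ‖G x * R x - 1‖ ≤ ‖F x * R x - 1‖ + ‖G x - F x‖ * ‖R x‖ := by
    rw [← norm_mul]
    calc ‖G x * R x - 1‖ = ‖(F x * R x - 1) + (G x - F x) * R x‖ := by ring_nf
      _ ≤ _ := norm_add_le _ _
  have h7 : ‖G x - F x‖ * ‖R x‖ ≤ m / 8 * ‖R x‖ :=
    mul_le_mul_of_nonneg_right h3 (norm_nonneg _)
  norm_num at h1
  linarith

/-- A predicate which is locally constant on a preconnected set is constant on it. -/
theorem iff_of_locally_iff {T : Type*} [TopologicalSpace T] {s : Set T} (hs : IsPreconnected s)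
    {P : T → Prop} (hP : ∀ t ∈ s, ∀ᶠ u in 𝓝[s] t, (P u ↔ P t)) {a b : T} (ha : a ∈ s)
    (hb : b ∈ s) : P a ↔ P b := by
  refine hs.induction₂ (fun x y => (P x ↔ P y)) (fun x hx => ?_) (fun x y z _ _ _ => Iff.trans)
    (fun x y _ _ => Iff.symm) ha hb
  filter_upwards [hP x hx] with u hu using hu.symm

/-- Oka's characterisation principle: invertibility propagates along nonvanishing families. -/
theorem InvOn.of_preconnected {E T : Type*} [TopologicalSpace E] [TopologicalSpace T]
    {A : Subalgebra ℂ (E → ℂ)} {K : Set E} (hK : IsCompact K) {s : Set T}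
    (hs : IsPreconnected s) {F : T → E → ℂ} (hA : ∀ t ∈ s, F t ∈ A)
    (hc : ContinuousOn (Function.uncurry F) (s ×ˢ K)) (hnz : ∀ t ∈ s, ∀ x ∈ K, F t x ≠ 0)
    {a b : T} (ha : a ∈ s) (hb : b ∈ s) (h : InvOn A K (F a)) : InvOn A K (F b) := by
  refine (iff_of_locally_iff hs (P := fun t => InvOn A K (F t)) (fun t ht => ?_) ha hb).1 h
  have hct : ContinuousOn (F t) K := by
    have : ContinuousOn (fun x => Function.uncurry F (t, x)) K :=
      hc.comp (by fun_prop) (fun x hx => ⟨ht, hx⟩)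
    exact this
  obtain ⟨m, hm, hlow⟩ : ∃ m > 0, ∀ x ∈ K, m ≤ ‖F t x‖ := by
    rcases K.eq_empty_or_nonempty with rfl | hne
    · exact ⟨1, one_pos, by simp⟩
    · obtain ⟨x, hx, hmin⟩ := hK.exists_isMinOn hne hct.norm
      exact ⟨_, norm_pos_iff.2 (hnz t ht x hx), fun y hy => hmin hy⟩
  have hev : ∀ᶠ u in 𝓝[s] t, ∀ x ∈ K, ‖F u x - F t x‖ < m / 16 := by
    refine (hK.eventually_forall_of_forall_eventually (x₀ := t)
      (P := fun u x => u ∈ s → x ∈ K → ‖F u x - F t x‖ < m / 16) ?_).filter_mono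
      nhdsWithin_le_nhds |>.and self_mem_nhdsWithin |>.mono fun u hu x hx => hu.1 x hx hu.2 hx
    intro x hx
    have h1 : ContinuousWithinAt (fun p : T × E => ‖F p.1 p.2 - F t p.2‖) (s ×ˢ K) (t, x) := by
      refine ContinuousWithinAt.norm (ContinuousWithinAt.sub (hc (t, x) ⟨ht, hx⟩) ?_)
      exact ContinuousWithinAt.comp (t := K) (hct x hx) continuousWithinAt_snd (fun p hp => hp.2)
    have h2 : ∀ᶠ p in 𝓝[s ×ˢ K] (t, x), ‖F p.1 p.2 - F t p.2‖ < m / 16 :=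
      h1.eventually_lt continuousWithinAt_const (by simp; positivity)
    rw [eventually_nhdsWithin_iff] at h2
    filter_upwards [h2] with p hp h1 h2 using hp ⟨h1, h2⟩
  filter_upwards [hev, self_mem_nhdsWithin] with u hu hus
  constructor
  · intro hinv
    refine hinv.of_close (hA u hus) (m := m / 2) (fun x hx => ?_)
      (fun x hx => ?_)
    · have := norm_sub_norm_le (F t x) (F u x)
      rw [norm_sub_rev] at this
      linarith [hu x hx, hlow x hx]
    · rw [norm_sub_rev]; linarith [hu x hx]
  · intro hinv
    exact hinv.of_close (hA t ht) hlow (fun x hx => by linarith [hu x hx])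

theorem InvOn.congr {E : Type*} {A : Subalgebra ℂ (E → ℂ)} {K : Set E} {F G : E → ℂ}
    (h : InvOn A K F) (hFG : EqOn F G K) : InvOn A K G := by
  obtain ⟨R, hR, hb⟩ := h
  exact ⟨R, hR, fun x hx => by rw [← hFG hx]; exact hb x hx⟩

/-- `f - c` is invertible as soon as `c` is large. -/
theorem invOn_sub_const_of_large {E : Type*} {A : Subalgebra ℂ (E → ℂ)} {K : Set E} {f : E → ℂ}
    {B : ℝ} (hB : ∀ x ∈ K, ‖f x‖ ≤ B) (hB0 : 0 ≤ B) {c : ℂ} (hc : 2 * B < ‖c‖) :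
    InvOn A K (fun x => f x - c) := by
  have hc0 : c ≠ 0 := by
    rintro rfl
    rw [norm_zero] at hc
    linarith
  refine ⟨algebraMap ℂ (E → ℂ) (-c⁻¹), A.algebraMap_mem _, fun x hx => ?_⟩
  have h1 : (f x - c) * (algebraMap ℂ (E → ℂ) (-c⁻¹)) x - 1 = - (f x * c⁻¹) := by
    simp only [Pi.algebraMap_apply, Algebra.algebraMap_self, RingHom.id_apply]
    field_simp
    ring
  have h2 : 0 < ‖c‖ := norm_pos_iff.2 hc0
  rw [h1, norm_neg, norm_mul, norm_inv, ← div_eq_mul_inv, div_lt_iff₀ h2]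
  linarith [hB x hx]

theorem mem_of_resolvent_combination_mem {A : Type*} [NormedCommRing A] [NormedAlgebra ℂ A]
    [CompleteSpace A] {P : Submodule ℂ A} (hP : IsClosed (P : Set A)) {e₁ e₂ a b : A}
    (hab : Disjoint (spectrum ℂ a) (spectrum ℂ b))
    (h : ∀ ζ ∈ resolventSet ℂ a, ζ ∈ resolventSet ℂ b →
      e₁ * resolvent a ζ + e₂ * resolvent b ζ ∈ P) : e₁ ∈ P := by
  classical
  have : IsClosed (P : Set A) := hP
  have hda : ∀ ζ ∈ resolventSet ℂ a, DifferentiableAt ℂ (fun ζ => P.mkQL (e₁ * resolvent a ζ)) ζ :=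
    fun ζ hζ => P.mkQL.differentiableAt.comp ζ
      ((spectrum.hasDerivAt_resolvent_const_left hζ).differentiableAt.const_mul e₁)
  have hdb : ∀ ζ ∈ resolventSet ℂ b, DifferentiableAt ℂ (fun ζ => P.mkQL (e₂ * resolvent b ζ)) ζ :=
    fun ζ hζ => P.mkQL.differentiableAt.comp ζ
      ((spectrum.hasDerivAt_resolvent_const_left hζ).differentiableAt.const_mul e₂)
  set Q : ℂ → A ⧸ P := fun ζ => if ζ ∈ resolventSet ℂ a then P.mkQL (e₁ * resolvent a ζ)
    else - P.mkQL (e₂ * resolvent b ζ) with hQ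
  have hQa : ∀ ζ ∈ resolventSet ℂ a, Q ζ = P.mkQL (e₁ * resolvent a ζ) := fun ζ hζ => if_pos hζ
  have hQb : ∀ ζ ∈ resolventSet ℂ b, Q ζ = - P.mkQL (e₂ * resolvent b ζ) := by
    intro ζ hζ
    by_cases hζa : ζ ∈ resolventSet ℂ a
    · rw [hQa ζ hζa, eq_neg_iff_add_eq_zero, ← map_add, Submodule.mkQL_apply,
        Submodule.mkQ_apply, Submodule.Quotient.mk_eq_zero]
      exact h ζ hζa hζ
    · exact if_neg hζa
  have hQd : Differentiable ℂ Q := by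
    intro ζ
    by_cases hζ : ζ ∈ resolventSet ℂ a
    · refine (hda ζ hζ).congr_of_eventuallyEq ?_
      filter_upwards [(spectrum.isOpen_resolventSet a).mem_nhds hζ] with u hu using hQa u hu
    · have hζb : ζ ∈ resolventSet ℂ b := by
        by_contra hb
        exact disjoint_left.1 hab hζ hb
      refine (hdb ζ hζb).neg.congr_of_eventuallyEq ?_
      filter_upwards [(spectrum.isOpen_resolventSet b).mem_nhds hζb] with u hu using hQb u hu
  have hev : ∀ᶠ ζ in Bornology.cobounded ℂ, ζ ∈ resolventSet ℂ a := by
    filter_upwards [(tendsto_norm_cobounded_atTop (E := ℂ)).eventually_gt_atTop (‖a‖ * ‖(1 : A)‖)]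
      with ζ hζ using spectrum.mem_resolventSet_of_norm_lt_mul hζ
  have hr := spectrum.resolvent_tendsto_cobounded (𝕜 := ℂ) a
  have hQ0 : Q = Function.const ℂ 0 := by
    refine hQd.eq_const_of_tendsto_cocompact ?_
    rw [← Metric.cobounded_eq_cocompact]
    have : Tendsto (fun ζ => P.mkQL (e₁ * resolvent a ζ)) (Bornology.cobounded ℂ) (𝓝 0) := by
      simpa using! (P.mkQL.continuous.tendsto _).comp (hr.const_mul e₁)
    refine this.congr' ?_
    filter_upwards [hev] with ζ hζ using (hQa ζ hζ).symm
  have hmem : ∀ᶠ ζ in Bornology.cobounded ℂ, e₁ + e₁ * a * resolvent a ζ ∈ P := by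
    filter_upwards [hev] with ζ hζ
    have h1 : e₁ * resolvent a ζ ∈ P := by
      have := hQa ζ hζ
      rw [hQ0] at this
      simpa using! this.symm
    have h2 : (algebraMap ℂ A ζ - a) * resolvent a ζ = 1 := Ring.mul_inverse_cancel _ hζ
    have h3 : e₁ + e₁ * a * resolvent a ζ = ζ • (e₁ * resolvent a ζ) := by
      rw [Algebra.smul_def]
      linear_combination (-e₁) * h2
    rw [h3]
    exact P.smul_mem _ h1
  have hlim : Tendsto (fun ζ => e₁ + e₁ * a * resolvent a ζ) (Bornology.cobounded ℂ) (𝓝 e₁) := by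
    simpa using (hr.const_mul (e₁ * a)).const_add e₁
  exact hP.mem_of_tendsto hlim hmem

/-- The algebra of polynomial functions on `ℂ`. -/
def polyAlg : Subalgebra ℂ (ℂ → ℂ) := (Polynomial.aeval (id : ℂ → ℂ)).range

theorem mem_polyAlg {F : ℂ → ℂ} : F ∈ polyAlg ↔ ∃ p : Polynomial ℂ, ∀ w, F w = p.eval w := by
  constructor
  · rintro ⟨p, rfl⟩
    exact ⟨p, fun w => by
      simp only [AlgHom.toRingHom_eq_coe, RingHom.coe_coe, Polynomial.aeval_fn_apply]; simp⟩
  · rintro ⟨p, hp⟩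
    refine ⟨p, funext fun w => ?_⟩
    simp only [AlgHom.toRingHom_eq_coe, RingHom.coe_coe, Polynomial.aeval_fn_apply, hp w]
    simp

theorem resolvent_mem_of_invOn {L : Set ℂ} [CompactSpace L] {c : ℂ}
    (h : InvOn polyAlg L (fun w => w - c)) {r : C(L, ℂ)}
    (hr : ∀ w : L, (c - w) * r w = 1) : r ∈ (polynomialFunctions L).topologicalClosure := by
  rw [← SetLike.mem_coe, Subalgebra.topologicalClosure_coe, Metric.mem_closure_iff]
  intro ε hε
  have hlim : Tendsto (fun k : ℕ => ‖r‖ * (1 / 2 : ℝ) ^ (k + 1)) atTop (𝓝 (‖r‖ * 0)) :=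
    ((tendsto_pow_atTop_nhds_zero_of_lt_one (by norm_num) (by norm_num)).comp
      (tendsto_add_atTop_nat 1)).const_mul _
  rw [mul_zero] at hlim
  obtain ⟨k, hk⟩ := (hlim.eventually_lt_const hε).exists
  have hmem : (fun w : ℂ => w - c) ∈ polyAlg := mem_polyAlg.2 ⟨.X - .C c, fun w => by simp⟩
  obtain ⟨R, hR, hb⟩ := h.exists_pow hmem k
  obtain ⟨p, hp⟩ := mem_polyAlg.1 hR
  refine ⟨(-p).toContinuousMapOn L, ?_, ?_⟩
  · rw [polynomialFunctions_coe]
    exact ⟨-p, rfl⟩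
  · refine lt_of_le_of_lt ?_ hk
    rw [ContinuousMap.dist_le (by positivity)]
    intro w
    have h1 := hb w w.2
    have h2 := hr w
    have h3 : r w - ((-p).toContinuousMapOn L) w = - (r w * ((w - c) * R w - 1)) := by
      simp only [Polynomial.toContinuousMapOn_apply, Polynomial.toContinuousMap_apply,
        Polynomial.eval_neg, ← hp]
      linear_combination (-R w) * h2
    rw [dist_eq_norm, h3, norm_neg, norm_mul]
    exact mul_le_mul (r.norm_coe_le_norm w) h1 (norm_nonneg _) (norm_nonneg _)

/-- On a compact set off which all `w - c` are invertible, locally constant functions are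
uniform limits of polynomials. -/
theorem exists_polynomial_separating {L₁ L₂ : Set ℂ} (h₁ : IsCompact L₁) (h₂ : IsCompact L₂)
    (hd : Disjoint L₁ L₂) (h : ∀ c ∉ L₁ ∪ L₂, InvOn polyAlg (L₁ ∪ L₂) (fun w => w - c))
    {ε : ℝ} (hε : 0 < ε) :
    ∃ p : Polynomial ℂ, (∀ w ∈ L₁, ‖p.eval w - 1‖ < ε) ∧ ∀ w ∈ L₂, ‖p.eval w‖ < ε := by
  classical
  rcases L₁.eq_empty_or_nonempty with rfl | ⟨p₁, hp₁⟩
  · exact ⟨0, by simp, by simpa using fun _ _ => hε⟩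
  rcases L₂.eq_empty_or_nonempty with rfl | ⟨p₂, hp₂⟩
  · exact ⟨1, by simpa using fun _ _ => hε, by simp⟩
  set L := L₁ ∪ L₂ with hL
  have : CompactSpace L := isCompact_iff_compactSpace.1 (h₁.union h₂)
  have hcont : ∀ u v : ℂ → ℂ, Continuous u → Continuous v →
      Continuous (fun w : L => if (w : ℂ) ∈ L₁ then u w else v w) := by
    intro u v hu hv
    refine continuous_if' ?_ ?_ ?_ ?_
    all_goals
      have hcl : IsClopen {w : L | (w : ℂ) ∈ L₁} := by
        refine ⟨h₁.isClosed.preimage continuous_subtype_val, ?_⟩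
        have : {w : L | (w : ℂ) ∈ L₁} = {w : L | (w : ℂ) ∈ L₂}ᶜ := by
          ext w
          constructor
          · intro hw hw2
            exact disjoint_left.1 hd hw hw2
          · intro hw
            exact w.2.resolve_right hw
        rw [this]
        exact (h₂.isClosed.preimage continuous_subtype_val).isOpen_compl
      first
        | (intro w hw; rw [hcl.frontier_eq] at hw; exact hw.elim)
        | fun_prop
  let e₁ : C(L, ℂ) := ⟨fun w => if (w : ℂ) ∈ L₁ then 1 else 0,
    hcont (fun _ => 1) (fun _ => 0) (by fun_prop) (by fun_prop)⟩
  let e₂ : C(L, ℂ) := ⟨fun w => if (w : ℂ) ∈ L₁ then 0 else 1,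
    hcont (fun _ => 0) (fun _ => 1) (by fun_prop) (by fun_prop)⟩
  let a : C(L, ℂ) := ⟨fun w => if (w : ℂ) ∈ L₁ then w else p₁,
    hcont (fun w => w) (fun _ => p₁) (by fun_prop) (by fun_prop)⟩
  let b : C(L, ℂ) := ⟨fun w => if (w : ℂ) ∈ L₁ then p₂ else w,
    hcont (fun _ => p₂) (fun w => w) (by fun_prop) (by fun_prop)⟩
  have ha : spectrum ℂ a ⊆ L₁ := by
    rw [ContinuousMap.spectrum_eq_range]
    rintro _ ⟨w, rfl⟩
    by_cases hw : (w : ℂ) ∈ L₁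
    · simp [a, hw]
    · simpa [a, hw] using hp₁
  have hb : spectrum ℂ b ⊆ L₂ := by
    rw [ContinuousMap.spectrum_eq_range]
    rintro _ ⟨w, rfl⟩
    by_cases hw : (w : ℂ) ∈ L₁
    · simpa [b, hw] using hp₂
    · simpa [b, hw] using w.2.resolve_left hw
  have hL₁ : L₁ ⊆ spectrum ℂ a := by
    rw [ContinuousMap.spectrum_eq_range]
    intro w hw
    exact ⟨⟨w, Or.inl hw⟩, by simp [a, hw]⟩
  have hL₂ : L₂ ⊆ spectrum ℂ b := by
    rw [ContinuousMap.spectrum_eq_range]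
    intro w hw
    exact ⟨⟨w, Or.inr hw⟩, by simp [b, disjoint_right.1 hd hw]⟩
  have key : e₁ ∈ Subalgebra.toSubmodule (polynomialFunctions L).topologicalClosure := by
    refine mem_of_resolvent_combination_mem (e₂ := e₂) (a := a) (b := b) ?_
      (hd.mono ha hb) ?_
    · exact Subalgebra.isClosed_topologicalClosure _
    · intro ζ hζa hζb
      have hζ : ζ ∉ L := by
        rintro (hζ | hζ)
        · exact hL₁ hζ hζa
        · exact hL₂ hζ hζb
      refine resolvent_mem_of_invOn (h ζ hζ) fun w => ?_
      have h3 : (algebraMap ℂ C(L, ℂ) ζ - a) * resolvent a ζ = 1 := Ring.mul_inverse_cancel _ hζa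
      have h4 : (algebraMap ℂ C(L, ℂ) ζ - b) * resolvent b ζ = 1 := Ring.mul_inverse_cancel _ hζb
      have h5 := DFunLike.congr_fun h3 w
      have h6 := DFunLike.congr_fun h4 w
      by_cases hw : (w : ℂ) ∈ L₁
      · simpa [e₁, e₂, a, hw] using h5
      · simpa [e₁, e₂, b, hw] using h6
  have key' : e₁ ∈ closure (polynomialFunctions L : Set C(L, ℂ)) := key
  rw [Metric.mem_closure_iff] at key'
  obtain ⟨q, hq, hdist⟩ := key' ε hε
  rw [polynomialFunctions_coe] at hq
  obtain ⟨p, rfl⟩ := hq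
  refine ⟨p, fun w hw => ?_, fun w hw => ?_⟩
  · have := (ContinuousMap.dist_apply_le_dist (f := e₁)
      (g := Polynomial.toContinuousMapOnAlgHom L p) ⟨w, Or.inl hw⟩).trans_lt hdist
    rw [dist_comm, dist_eq_norm] at this
    simpa [e₁, hw] using this
  · have := (ContinuousMap.dist_apply_le_dist (f := e₁)
      (g := Polynomial.toContinuousMapOnAlgHom L p) ⟨w, Or.inr hw⟩).trans_lt hdist
    rw [dist_comm, dist_eq_norm] at this
    simpa [e₁, disjoint_right.1 hd hw] using this

theorem isPreconnected_norm_gt (R : ℝ) : IsPreconnected {x : ℝ × ℝ | R < ‖x‖} := by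
  rcases lt_or_ge R 0 with hR | hR
  · have : {x : ℝ × ℝ | R < ‖x‖} = univ := eq_univ_of_forall fun x => hR.trans_le (norm_nonneg x)
    rw [this]
    exact isPreconnected_univ
  have h1 : IsPreconnected (Ioi R ×ˢ Metric.sphere (0 : ℝ × ℝ) 1) := by
    refine isPreconnected_Ioi.prod (isPreconnected_sphere ?_ 0 1)
    rw [rank_prod', Module.rank_self]
    norm_num
  have h2 := h1.image (fun p : ℝ × (ℝ × ℝ) => p.1 • p.2) (by fun_prop)
  convert h2 using 1
  ext x
  constructor
  · intro hx
    have hx0 : 0 < ‖x‖ := hR.trans_lt hx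
    refine ⟨(‖x‖, ‖x‖⁻¹ • x), ⟨hx, ?_⟩, ?_⟩
    · rw [mem_sphere_zero_iff_norm, norm_smul, norm_inv, norm_norm, inv_mul_cancel₀ hx0.ne']
    · simp only [smul_smul, mul_inv_cancel₀ hx0.ne', one_smul]
  · rintro ⟨⟨r, y⟩, ⟨hr, hy⟩, rfl⟩
    rw [mem_sphere_zero_iff_norm] at hy
    have hr' : R < r := hr
    simp only [mem_ofPred_eq, norm_smul, hy, mul_one, Real.norm_eq_abs, abs_of_pos (hR.trans_lt hr')]
    exact hr'

/-- A bounded open set whose frontier lies in the unit ball lies in the unit ball. -/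
theorem subset_closedBall_of_frontier_subset {W : Set (ℝ × ℝ)} (hW : IsOpen W)
    (hb : Bornology.IsBounded W) (hf : frontier W ⊆ Metric.closedBall 0 1) :
    W ⊆ Metric.closedBall 0 1 := by
  rcases W.eq_empty_or_nonempty with rfl | hne
  · simp
  obtain ⟨y, hy, hmax⟩ := hb.isCompact_closure.exists_isMaxOn hne.closure continuous_norm.continuousOn
  suffices h : ‖y‖ ≤ 1 by
    intro x hx
    rw [mem_closedBall_zero_iff]
    exact (hmax (subset_closure hx)).trans h
  by_cases hyW : y ∈ W
  · have h1 : ∀ᶠ s in 𝓝 (1 : ℝ), s • y ∈ W := by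
      have : ContinuousAt (fun s : ℝ => s • y) 1 := by fun_prop
      exact this.eventually_mem (by simpa using hW.mem_nhds hyW)
    obtain ⟨s, hs, hs1⟩ := ((h1.filter_mono (nhdsWithin_le_nhds (s := Ioi 1))).and
      self_mem_nhdsWithin).exists
    have h2 : ‖s • y‖ ≤ ‖y‖ := hmax (subset_closure hs)
    have hs1' : 1 < s := hs1
    rw [norm_smul, Real.norm_eq_abs, abs_of_pos (by linarith)] at h2
    nlinarith [norm_nonneg y]
  · have : y ∈ frontier W := ⟨hy, by rwa [hW.interior_eq]⟩
    simpa using hf this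

/-- A function without local extrema on the unit ball is not constant on the frontier of a nonempty
bounded open set, if that frontier lies in the unit ball. -/
theorem frontier_level_false {g : ℝ × ℝ → ℝ} (hg : Continuous g) {t : ℝ}
    (hmax : ∀ x ∈ Metric.closedBall (0 : ℝ × ℝ) 1, ∃ᶠ y in 𝓝 x, g x < g y)
    (hmin : ∀ x ∈ Metric.closedBall (0 : ℝ × ℝ) 1, ∃ᶠ y in 𝓝 x, g y < g x)
    {W : Set (ℝ × ℝ)} (hW : IsOpen W) (hne : W.Nonempty) (hb : Bornology.IsBounded W)
    (hf : frontier W ⊆ Metric.closedBall 0 1) (hgt : ∀ x ∈ frontier W, g x = t) : False := by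
  have hWQ := subset_closedBall_of_frontier_subset hW hb hf
  obtain ⟨y, hy, hymax⟩ := hb.isCompact_closure.exists_isMaxOn hne.closure hg.continuousOn
  obtain ⟨z, hz, hzmin⟩ := hb.isCompact_closure.exists_isMinOn hne.closure hg.continuousOn
  have hgy : g y = t := by
    by_cases hyW : y ∈ W
    · obtain ⟨x, hx, hxW⟩ := ((hmax y (hWQ hyW)).and_eventually (hW.mem_nhds hyW)).exists
      exact absurd (hymax (subset_closure hxW)) (not_le.2 hx)
    · exact hgt y ⟨hy, by rwa [hW.interior_eq]⟩
  have hgz : g z = t := by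
    by_cases hzW : z ∈ W
    · obtain ⟨x, hx, hxW⟩ := ((hmin z (hWQ hzW)).and_eventually (hW.mem_nhds hzW)).exists
      exact absurd (hzmin (subset_closure hxW)) (not_le.2 hx)
    · exact hgt z ⟨hz, by rwa [hW.interior_eq]⟩
  obtain ⟨w, hw⟩ := hne
  obtain ⟨x, hx, hxW⟩ := ((hmax w (hWQ hw)).and_eventually (hW.mem_nhds hw)).exists
  have h1 : g x ≤ g y := hymax (subset_closure hxW)
  have h2 : g z ≤ g w := hzmin (subset_closure hw)
  linarith

theorem eq_of_abs_sub_int_lt {a b : ℤ} {x y : ℝ} (h : x - a = y - b) (hxy : |x - y| < 1) :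
    a = b := by
  have h1 : |((a - b : ℤ) : ℝ)| < 1 := by
    push_cast
    rwa [show (a : ℝ) - b = x - y by linarith]
  have h2 : |a - b| < 1 := by exact_mod_cast h1
  have := Int.abs_lt_one_iff.1 h2
  omega

/-- A compact, relatively open piece of a level set in the unit ball forces a critical point. -/
theorem no_compact_open_level_piece {g : ℝ × ℝ → ℝ} (hg : Continuous g) {t : ℝ}
    (hmax : ∀ x ∈ Metric.closedBall (0 : ℝ × ℝ) 1, ∃ᶠ y in 𝓝 x, g x < g y)
    (hmin : ∀ x ∈ Metric.closedBall (0 : ℝ × ℝ) 1, ∃ᶠ y in 𝓝 x, g y < g x)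
    {M : Set (ℝ × ℝ)} (hM : IsCompact M) (hne : M.Nonempty) (hMQ : M ⊆ Metric.closedBall 0 1)
    (hMt : ∀ x ∈ M, g x = t) (hopen : ∀ x ∈ M, ∀ᶠ y in 𝓝 x, g y = t → y ∈ M) : False := by
  classical
  obtain ⟨O, hO, hMO, hclO, hOc⟩ := exists_open_between_and_isCompact_closure hM
    (U := {y | ∀ᶠ z in 𝓝 y, g z = t → z ∈ M}) isOpen_setOfPred_eventually_nhds hopen
  have hOM : ∀ y ∈ closure O, g y = t → y ∈ M := fun y hy => (hclO hy).self_of_nhds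
  obtain ⟨δ, hδ, hδO⟩ : ∃ δ > 0, ∀ y ∈ frontier O, δ ≤ |g y - t| := by
    have hfc : IsCompact (frontier O) := hOc.of_isClosed_subset isClosed_frontier
      frontier_subset_closure
    rcases (frontier O).eq_empty_or_nonempty with h0 | h0
    · exact ⟨1, one_pos, by simp [h0]⟩
    · obtain ⟨x, hx, hxm⟩ := hfc.exists_isMinOn h0 (f := fun y => |g y - t|) (by fun_prop)
      refine ⟨|g x - t|, abs_pos.2 fun h => ?_, fun y hy => hxm hy⟩
      have hxM := hOM x (frontier_subset_closure hx) (by linarith)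
      rw [hO.frontier_eq] at hx
      exact hx.2 (hMO hxM)
  set θ : ℝ × ℝ → ℝ := fun x => max 0 (min 1 ((g x - t) / δ + 1 / 2)) with hθ
  have hθc : Continuous θ := by fun_prop
  have hθ0 : ∀ x, 0 ≤ θ x := fun x => le_max_left _ _
  have hθ1 : ∀ x, θ x ≤ 1 := fun x => max_le zero_le_one (min_le_left _ _)
  have hθhalf : ∀ x, θ x = 1 / 2 → g x = t := by
    intro x hx
    simp only [hθ] at hx
    have : (g x - t) / δ + 1 / 2 = 1 / 2 := by
      rcases le_total 1 ((g x - t) / δ + 1 / 2) with h | h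
      · rw [min_eq_left h] at hx; norm_num at hx
      · rw [min_eq_right h] at hx
        rcases le_total 0 ((g x - t) / δ + 1 / 2) with h' | h'
        · rwa [max_eq_right h'] at hx
        · rw [max_eq_left h'] at hx; norm_num at hx
    have h2 : (g x - t) / δ = 0 := by linarith
    rcases div_eq_zero_iff.1 h2 with h3 | h3 <;> linarith
  have hθpos : ∀ x, t < g x → 1 / 2 < θ x := by
    intro x hx
    have : 0 < (g x - t) / δ := div_pos (by linarith) hδ
    refine lt_max_of_lt_right (lt_min (by norm_num) (by linarith))
  have hθneg : ∀ x, g x < t → θ x < 1 / 2 := by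
    intro x hx
    have : (g x - t) / δ < 0 := div_neg_of_neg_of_pos (by linarith) hδ
    exact max_lt (by norm_num) (min_lt_of_right_lt (by linarith))
  set Θ : ℝ × ℝ → ℂ := O.piecewise (fun x => Complex.exp (2 * Real.pi * Complex.I * θ x))
    (fun _ => 1) with hΘ
  have hΘc : Continuous Θ := by
    refine Continuous.piecewise (fun x hx => ?_) (by fun_prop) continuous_const
    have h1 := hδO x hx
    rcases le_abs.1 h1 with h2 | h2
    · have : 1 ≤ (g x - t) / δ := (one_le_div hδ).2 h2
      have : θ x = 1 := by
        simp only [hθ]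
        rw [min_eq_left (by linarith)]; norm_num
      rw [this]; simp
    · have : 1 ≤ -(g x - t) / δ := (one_le_div hδ).2 h2
      rw [neg_div] at this
      have : θ x = 0 := by
        simp only [hθ]
        exact max_eq_left (min_le_of_right_le (by linarith))
      rw [this]; simp
  obtain ⟨f, hfc, hf⟩ := Complex.exists_continuousOn_eqOn_exp_comp (X := ℝ × ℝ) (U := univ)
    (by
      have : ContractibleSpace (univ : Set (ℝ × ℝ)) :=
        (Homeomorph.Set.univ (ℝ × ℝ)).contractibleSpace
      exact SimplyConnectedSpace.ofContractible _) isOpen_univ hΘc.continuousOn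
    (by
      rintro ⟨x, -, hx⟩
      by_cases hxO : x ∈ O
      · simp only [hΘ, Set.piecewise_eq_of_mem _ _ _ hxO] at hx
        exact Complex.exp_ne_zero _ hx
      · simp only [hΘ, Set.piecewise_eq_of_notMem _ _ _ hxO] at hx
        exact one_ne_zero hx)
  set ν : ℝ × ℝ → ℝ := fun x => (f x).im / (2 * Real.pi) with hν
  have hνc : Continuous ν := by
    have := continuousOn_univ.1 hfc
    fun_prop
  have hpi : (0 : ℝ) < 2 * Real.pi := Real.two_pi_pos
  have hνim : ∀ x, (f x).im = 2 * Real.pi * ν x := fun x => by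
    simp only [hν]; field_simp
  have hνO : ∀ x ∈ O, ∃ n : ℤ, ν x = θ x + n := by
    intro x hx
    have h1 : Complex.exp (f x) = Complex.exp (2 * Real.pi * Complex.I * θ x) := by
      have := hf (mem_univ x)
      simpa [hΘ, Set.piecewise_eq_of_mem _ _ _ hx] using this
    obtain ⟨n, hn⟩ := Complex.exp_eq_exp_iff_exists_int.1 h1
    have h2 := congrArg Complex.im hn
    rw [hνim] at h2
    simp at h2
    refine ⟨n, ?_⟩
    have h3 : 2 * Real.pi * ν x = 2 * Real.pi * (θ x + n) := by rw [h2]; ring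
    exact mul_left_cancel₀ hpi.ne' h3
  have hνO' : ∀ x ∉ O, ∃ n : ℤ, ν x = n := by
    intro x hx
    have h1 : Complex.exp (f x) = 1 := by
      have := hf (mem_univ x)
      simpa [hΘ, Set.piecewise_eq_of_notMem _ _ _ hx] using this
    obtain ⟨n, hn⟩ := Complex.exp_eq_one_iff.1 h1
    have h2 := congrArg Complex.im hn
    rw [hνim] at h2
    simp at h2
    refine ⟨n, ?_⟩
    have h3 : 2 * Real.pi * ν x = 2 * Real.pi * n := by rw [h2]; ring
    exact mul_left_cancel₀ hpi.ne' h3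
  obtain ⟨R, hR⟩ := hOc.isBounded.subset_closedBall 0
  have hfar : ∀ x ∈ {x : ℝ × ℝ | R < ‖x‖}, x ∉ O := by
    intro x hx hxO
    have h1 : x ∈ Metric.closedBall (0 : ℝ × ℝ) R := hR (subset_closure hxO)
    rw [mem_closedBall_zero_iff] at h1
    exact absurd h1 (not_le.2 hx)
  obtain ⟨x₁, hx₁⟩ := hne
  have hx₁t := hMt x₁ hx₁
  have hθx₁ : θ x₁ = 1 / 2 := by
    simp only [hθ, hx₁t]; norm_num
  obtain ⟨m, hm⟩ := hνO x₁ (hMO hx₁)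
  rw [hθx₁] at hm
  have hlev : ∀ y, ν y = 1 / 2 + m → y ∈ M := by
    intro y hy
    have hnothalf : ∀ k : ℤ, (1 / 2 : ℝ) ≠ k := by
      intro k hk
      have : (1 : ℝ) = ((2 * k : ℤ) : ℝ) := by push_cast; linarith
      have : (1 : ℤ) = 2 * k := by exact_mod_cast this
      omega
    by_cases hyO : y ∈ O
    · obtain ⟨n, hn⟩ := hνO y hyO
      have h1 : n = m := by
        refine eq_of_abs_sub_int_lt (x := 1 / 2) (y := θ y) ?_ ?_
        · linarith
        · rw [abs_lt]
          constructor <;> linarith [hθ0 y, hθ1 y]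
      refine hOM y (subset_closure hyO) (hθhalf y ?_)
      rw [h1] at hn
      linarith
    · obtain ⟨n, hn⟩ := hνO' y hyO
      exact absurd (show (1 / 2 : ℝ) = ((n - m : ℤ) : ℝ) by push_cast; linarith) (hnothalf _)
  have hnear : ∀ᶠ y in 𝓝 x₁, ν y = θ y + m := by
    have h1 : ∀ᶠ y in 𝓝 x₁, |ν y - θ y - m| < 1 := by
      have : ContinuousAt (fun y => |ν y - θ y - m|) x₁ := by fun_prop
      refine this.eventually_lt_const ?_
      simp only [hm, hθx₁]
      norm_num
    filter_upwards [h1, hO.mem_nhds (hMO hx₁)] with y hy hyO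
    obtain ⟨n, hn⟩ := hνO y hyO
    have h2 : |((n - m : ℤ) : ℝ)| < 1 := by
      push_cast
      convert hy using 2
      linarith
    have h3 : |n - m| < 1 := by exact_mod_cast h2
    have h4 := Int.abs_lt_one_iff.1 h3
    rw [hn, show n = m by omega]
  have hconst : ∀ x ∈ {x : ℝ × ℝ | R < ‖x‖}, ∀ y ∈ {x : ℝ × ℝ | R < ‖x‖}, ν x = ν y := by
    intro x hx y hy
    refine (isPreconnected_norm_gt R).constant_of_mapsTo (T := range ((↑) : ℤ → ℝ)) (f := ν)
      Int.isClosedEmbedding_coe_real.isEmbedding.isDiscrete_range hνc.continuousOn (fun z hz => ?_) hx hy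
    obtain ⟨n, hn⟩ := hνO' z (hfar z hz)
    exact ⟨n, hn.symm⟩
  obtain ⟨x₀, hx₀⟩ : ∃ x₀ : ℝ × ℝ, R < ‖x₀‖ := NormedSpace.exists_lt_norm ℝ _ R
  have hbdd : ∀ V : Set (ℝ × ℝ), (∀ x ∈ V, ν x ≠ ν x₀) → Bornology.IsBounded V := by
    intro V hV
    refine (Metric.isBounded_closedBall (x := (0 : ℝ × ℝ)) (r := R)).subset fun x hx => ?_
    rw [mem_closedBall_zero_iff]
    by_contra hlt
    exact hV x hx (hconst x (not_le.1 hlt) x₀ hx₀)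
  rcases le_total (ν x₀) (1 / 2 + m) with hle | hle
  · have hWo : IsOpen {x | 1 / 2 + m < ν x} := isOpen_lt continuous_const hνc
    have hfr : ∀ x ∈ frontier {x | 1 / 2 + m < ν x}, x ∈ M := fun x hx =>
      hlev x (frontier_lt_subset_eq continuous_const hνc hx).symm
    refine frontier_level_false hg (t := t) hmax hmin hWo ?_ (hbdd _ fun x hx => ?_)
      (fun x hx => hMQ (hfr x hx)) (fun x hx => hMt x (hfr x hx))
    · obtain ⟨y, hy, hy'⟩ := ((hmax x₁ (hMQ hx₁)).and_eventually hnear).exists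
      exact ⟨y, by
        have := hθpos y (hx₁t ▸ hy)
        simp only [mem_ofPred_eq]; linarith⟩
    · exact (hle.trans_lt hx).ne'
  · have hWo : IsOpen {x | ν x < 1 / 2 + m} := isOpen_lt hνc continuous_const
    have hfr : ∀ x ∈ frontier {x | ν x < 1 / 2 + m}, x ∈ M := fun x hx =>
      hlev x (frontier_lt_subset_eq hνc continuous_const hx)
    refine frontier_level_false hg (t := t) hmax hmin hWo ?_ (hbdd _ fun x hx => ?_)
      (fun x hx => hMQ (hfr x hx)) (fun x hx => hMt x (hfr x hx))
    · obtain ⟨y, hy, hy'⟩ := ((hmin x₁ (hMQ hx₁)).and_eventually hnear).exists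
      exact ⟨y, by
        have := hθneg y (hx₁t ▸ hy)
        simp only [mem_ofPred_eq]; linarith⟩
    · exact (lt_of_lt_of_le hx hle).ne

theorem exists_openPartialHomeomorph_of_injective {V : Type*} [NormedAddCommGroup V]
    [NormedSpace ℝ V] [FiniteDimensional ℝ V] (hV : Module.finrank ℝ V = 2) {F : ℝ × ℝ → V}
    (hF : ContDiff ℝ 1 F) {x : ℝ × ℝ} (hinj : ∀ u, fderiv ℝ F x u = 0 → u = 0) :
    ∃ E : OpenPartialHomeomorph (ℝ × ℝ) V, x ∈ E.source ∧ ∀ y, E y = F y := by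
  have hfin : Module.finrank ℝ (ℝ × ℝ) = Module.finrank ℝ V := by
    rw [hV, Module.finrank_prod, Module.finrank_self]
  have hinj' : Function.Injective (fderiv ℝ F x : ℝ × ℝ →ₗ[ℝ] V) :=
    (injective_iff_map_eq_zero _).2 hinj
  set e : (ℝ × ℝ) ≃L[ℝ] V :=
    (LinearEquiv.ofInjectiveOfFinrankEq _ hinj' hfin).toContinuousLinearEquiv with he
  have hstrict : HasStrictFDerivAt F (e : ℝ × ℝ →L[ℝ] V) x := by
    have h1 := hF.hasStrictFDerivAt (x := x) one_ne_zero
    have he' : (e : ℝ × ℝ →L[ℝ] V) = fderiv ℝ F x := ContinuousLinearMap.ext fun _ => rfl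
    rw [he']
    exact h1
  exact ⟨hstrict.toOpenPartialHomeomorph F, hstrict.mem_toOpenPartialHomeomorph_source,
    fun y => congrFun hstrict.toOpenPartialHomeomorph_coe y⟩

/-- Points of a compact set whose image under an injective continuous map is close to the image of
`x` are close to `x`. -/
theorem eventually_mem_of_image_near {X Y : Type*} [TopologicalSpace X] [TopologicalSpace Y]
    [T2Space Y] {ψ : X → Y} {S : Set X} (hS : IsCompact S) (hψ : ContinuousOn ψ S)
    (hinj : InjOn ψ S) {x : X} (hx : x ∈ S) {V : Set X} (hV : V ∈ 𝓝 x) :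
    ∀ᶠ w in 𝓝 (ψ x), ∀ y ∈ S, ψ y = w → y ∈ V := by
  obtain ⟨O, hOV, hO, hxO⟩ := mem_nhds_iff.1 hV
  have hc : IsCompact (ψ '' (S \ O)) := (hS.diff hO).image_of_continuousOn (hψ.mono sdiff_subset)
  have hnot : ψ x ∉ ψ '' (S \ O) := by
    rintro ⟨y, hy, hyx⟩
    exact hy.2 (hinj hy.1 hx hyx ▸ hxO)
  filter_upwards [hc.isClosed.isOpen_compl.mem_nhds hnot] with w hw y hy hyw
  by_contra hyV
  exact hw ⟨y, ⟨hy, fun hyO => hyV (hOV hyO)⟩, hyw⟩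

theorem exists_level_charts {g : ℝ × ℝ → ℝ} {ψ : ℝ × ℝ → ℂ} (hg : ContDiff ℝ 1 g)
    (hψ : ContDiff ℝ 1 ψ) {x : ℝ × ℝ} (hdg : fderiv ℝ g x ≠ 0)
    (htr : ∀ u, fderiv ℝ g x u = 0 → fderiv ℝ ψ x u = 0 → u = 0) :
    (∃ k : ℝ × ℝ →L[ℝ] ℝ, ∃ E : OpenPartialHomeomorph (ℝ × ℝ) (ℝ × ℝ), x ∈ E.source ∧
      ∀ y, E y = (g y - g x, k (y - x))) ∧
    ∃ a : ℂ, ∃ E : OpenPartialHomeomorph (ℝ × ℝ) ℂ, x ∈ E.source ∧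
      ∀ y, E y = ψ y + (g y - g x) • a := by
  have hgd : DifferentiableAt ℝ g x := hg.contDiffAt.differentiableAt one_ne_zero
  have hψd : DifferentiableAt ℝ ψ x := hψ.contDiffAt.differentiableAt one_ne_zero
  set A := fderiv ℝ g x with hA
  set B := fderiv ℝ ψ x with hB
  obtain ⟨e', he'⟩ : ∃ e', A e' = 1 := by
    obtain ⟨v, hv⟩ : ∃ v, A v ≠ 0 := by
      by_contra! h
      exact hdg (ContinuousLinearMap.ext h)
    exact ⟨(A v)⁻¹ • v, by simp [hv]⟩
  obtain ⟨e, he, he0⟩ : ∃ e, A e = 0 ∧ e ≠ 0 := by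
    by_contra! h
    have h1 := LinearMap.finrank_le_finrank_of_injective (f := (A : ℝ × ℝ →ₗ[ℝ] ℝ))
      ((injective_iff_map_eq_zero _).2 h)
    rw [Module.finrank_prod, Module.finrank_self] at h1
    omega
  have hdecomp : ∀ u, ∃ s : ℝ, u = s • e + A u • e' := by
    intro u
    have hspan : Module.finrank ℝ (LinearMap.ker (A : ℝ × ℝ →ₗ[ℝ] ℝ)) = 1 := by
      have h1 := LinearMap.finrank_range_add_finrank_ker (A : ℝ × ℝ →ₗ[ℝ] ℝ)
      have h2 : LinearMap.range (A : ℝ × ℝ →ₗ[ℝ] ℝ) = ⊤ := by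
        rw [LinearMap.range_eq_top]
        intro r
        exact ⟨r • e', by simp [he']⟩
      rw [h2, finrank_top, Module.finrank_prod, Module.finrank_self] at h1
      omega
    obtain ⟨s, hs⟩ := (finrank_eq_one_iff_of_nonzero'
      (⟨e, by simpa using he⟩ : LinearMap.ker (A : ℝ × ℝ →ₗ[ℝ] ℝ)) (by
        simpa [Subtype.ext_iff] using he0)).1 hspan ⟨u - A u • e', by simp [he']⟩
    refine ⟨s, ?_⟩
    have := congrArg Subtype.val hs
    simp only [Submodule.coe_smul] at this
    rw [this]; abel
  have hBe : B e ≠ 0 := fun h => he0 (htr e he h)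
  constructor
  · obtain ⟨k, hk⟩ : ∃ k : ℝ × ℝ →L[ℝ] ℝ, k e ≠ 0 := by
      by_contra! h
      refine he0 (Prod.ext ?_ ?_)
      · simpa using h (ContinuousLinearMap.fst ℝ ℝ ℝ)
      · simpa using h (ContinuousLinearMap.snd ℝ ℝ ℝ)
    refine ⟨k, exists_openPartialHomeomorph_of_injective
      (F := fun y => (g y - g x, k (y - x))) (by simp) (by fun_prop) fun u hu => ?_⟩
    have hd : HasFDerivAt (fun y => (g y - g x, k (y - x))) (A.prod k) x :=
      (hgd.hasFDerivAt.sub_const _).prodMk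
        (k.hasFDerivAt.comp x ((hasFDerivAt_id x).sub_const x))
    rw [hd.fderiv] at hu
    simp only [ContinuousLinearMap.prod_apply, Prod.mk_eq_zero] at hu
    obtain ⟨s, hs⟩ := hdecomp u
    rw [hu.1, zero_smul, add_zero] at hs
    have h2 : k u = 0 := hu.2
    rw [hs, map_smul, smul_eq_mul, mul_eq_zero, or_iff_left hk] at h2
    rw [hs, h2, zero_smul]
  · refine ⟨Complex.I * B e - B e', exists_openPartialHomeomorph_of_injective
      (F := fun y => ψ y + (g y - g x) • (Complex.I * B e - B e')) Complex.finrank_real_complex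
      (by fun_prop) fun u hu => ?_⟩
    have hd : HasFDerivAt (fun y => ψ y + (g y - g x) • (Complex.I * B e - B e'))
        (B + A.smulRight (Complex.I * B e - B e')) x :=
      hψd.hasFDerivAt.add ((hgd.hasFDerivAt.sub_const _).smul_const _)
    rw [hd.fderiv] at hu
    obtain ⟨s, hs⟩ := hdecomp u
    have h1 : B u = s • B e + A u • B e' := by
      conv_lhs => rw [hs]
      simp
    have h2 : ((s : ℂ) + A u * Complex.I) * B e = 0 := by
      rw [← hu]
      simp only [add_apply, ContinuousLinearMap.smulRight_apply, h1, Complex.real_smul]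
      ring
    have h3 := (mul_eq_zero.1 h2).resolve_right hBe
    have hre := congrArg Complex.re h3
    have him := congrArg Complex.im h3
    simp at hre him
    rw [hs, hre, him, zero_smul, zero_smul, add_zero]

theorem flat_separation {L W : Set ℂ} (hW : IsOpen W)
    (hWc : IsOpen (Lᶜ \ W)) (E : OpenPartialHomeomorph (ℝ × ℝ) ℂ) (h0 : (0 : ℝ × ℝ) ∈ E.source)
    (hE : ∀ᶠ p in 𝓝 (0 : ℝ × ℝ), E p ∈ L → p.1 = 0) (hfr : E 0 ∈ frontier (closure W)) :
    ∀ᶠ p in 𝓝 (0 : ℝ × ℝ), p.1 = 0 → E p ∈ L ∧ E p ∈ frontier (closure W) := by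
  obtain ⟨r, hr, hbox⟩ := Metric.eventually_nhds_iff_ball.1 (hE.and (E.open_source.mem_nhds h0))
  have hbox' : ∀ p : ℝ × ℝ, |p.1| < r → |p.2| < r → p ∈ Metric.ball (0 : ℝ × ℝ) r := by
    intro p h1 h2
    rw [mem_ball_zero_iff, Prod.norm_def]
    exact max_lt h1 h2
  set box : Set (ℝ × ℝ) := Metric.ball 0 r with hboxdef
  have hcont : ContinuousOn E box := E.continuousOn.mono fun p hp => (hbox p hp).2
  have himo : ∀ V ⊆ box, IsOpen V → IsOpen (E '' V) := fun V hV hVo =>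
    E.isOpen_image_of_subset_source hVo fun p hp => (hbox p (hV hp)).2
  have half : ∀ σ : ℝ, (σ = 1 ∨ σ = -1) → ∃ H : Set (ℝ × ℝ), IsOpen H ∧ H ⊆ box ∧
      IsPreconnected H ∧ (∀ p ∈ box, p ∈ H ↔ 0 < σ * p.1) ∧
      ∀ p ∈ box, p.1 = 0 → p ∈ closure H := by
    intro σ hσ
    refine ⟨box ∩ {p | 0 < σ * p.1}, Metric.isOpen_ball.inter
      (isOpen_lt continuous_const (by fun_prop)), inter_subset_left, ?_, fun p hp => ?_,
      fun p hp hp0 => ?_⟩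
    · refine ((convex_ball _ _).inter ?_).isPreconnected
      exact convex_halfSpace_gt (f := fun p : ℝ × ℝ => σ * p.1)
        ⟨fun x y => by simp [mul_add], fun c x => by simp; ring⟩ 0
    · exact ⟨fun h => h.2, fun h => ⟨hp, h⟩⟩
    · have hlim : Tendsto (fun s : ℝ => p + s • ((σ, 0) : ℝ × ℝ)) (𝓝[>] 0) (𝓝 p) := by
        have : ContinuousAt (fun s : ℝ => p + s • ((σ, 0) : ℝ × ℝ)) 0 := by fun_prop
        have h2 := this.tendsto.mono_left (nhdsWithin_le_nhds (s := Ioi 0))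
        simpa using h2
      refine mem_closure_of_tendsto hlim ?_
      filter_upwards [hlim.eventually_mem (Metric.isOpen_ball.mem_nhds hp), self_mem_nhdsWithin]
        with s hs hs0
      refine ⟨hs, ?_⟩
      have hs0' : 0 < s := hs0
      rcases hσ with rfl | rfl <;> simp [hp0, hs0']
  obtain ⟨P, hPo, hPb, hPc, hPm, hPcl⟩ := half 1 (Or.inl rfl)
  obtain ⟨N, hNo, hNb, hNc, hNm, hNcl⟩ := half (-1) (Or.inr rfl)
  have hzero : ∀ p ∈ box, p ∉ P → p ∉ N → p.1 = 0 := by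
    intro p hp h1 h2
    rw [hPm p hp] at h1
    rw [hNm p hp] at h2
    linarith
  have hP0 : ∀ p ∈ P, p.1 ≠ 0 := fun p hp h => by
    have := (hPm p (hPb hp)).1 hp; rw [h] at this; simp at this
  have hN0 : ∀ p ∈ N, p.1 ≠ 0 := fun p hp h => by
    have := (hNm p (hNb hp)).1 hp; rw [h] at this; simp at this
  have dich : ∀ T ⊆ box, IsPreconnected T → (∀ p ∈ T, E p ∉ L) →
      (∀ p ∈ T, E p ∈ W) ∨ ∀ p ∈ T, E p ∉ W := by
    intro T hTb hT hTL
    have h1 := hT.image E (hcont.mono hTb)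
    have h2 : E '' T ⊆ W ∪ (Lᶜ \ W) := by
      rintro _ ⟨p, hp, rfl⟩
      by_cases h : E p ∈ W
      · exact Or.inl h
      · exact Or.inr ⟨hTL p hp, h⟩
    have h3 : Disjoint W (Lᶜ \ W) := disjoint_sdiff_right
    rcases (E '' T ∩ W).eq_empty_or_nonempty with he | he
    · right
      intro p hp hpW
      have : E p ∈ E '' T ∩ W := ⟨mem_image_of_mem _ hp, hpW⟩
      rw [he] at this
      exact this
    · left
      have h4 := h1.subset_left_of_subset_union hW hWc h3 h2 he
      exact fun p hp => h4 (mem_image_of_mem _ hp)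
  have hboxE : E '' box ∈ 𝓝 (E 0) :=
    (himo box Subset.rfl Metric.isOpen_ball).mem_nhds (mem_image_of_mem _ (Metric.mem_ball_self hr))
  have hfrcl : E 0 ∈ closure W := by
    have := frontier_subset_closure hfr
    rwa [closure_closure] at this
  have hclim : ∀ V ⊆ box, (∀ p ∈ V, E p ∈ W) → ∀ p ∈ box, p ∈ closure V → E p ∈ closure W := by
    intro V _ hVW p hp hpV
    have h1 : ContinuousWithinAt E V p := (E.continuousAt (hbox p hp).2).continuousWithinAt
    exact h1.mem_closure hpV hVW
  have notboth : ¬((∀ p ∈ P, E p ∈ W) ∧ ∀ p ∈ N, E p ∈ W) := by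
    rintro ⟨h1, h2⟩
    refine hfr.2 (mem_interior_iff_mem_nhds.2 (mem_of_superset hboxE ?_))
    rintro _ ⟨p, hp, rfl⟩
    by_cases hpP : p ∈ P
    · exact subset_closure (h1 p hpP)
    by_cases hpN : p ∈ N
    · exact subset_closure (h2 p hpN)
    · exact hclim P hPb h1 p hp (hPcl p hp (hzero p hp hpP hpN))
  have notnone : ¬((∀ p ∈ P, E p ∉ W) ∧ ∀ p ∈ N, E p ∉ W) := by
    rintro ⟨h1, h2⟩
    obtain ⟨w, hwE, hwW⟩ := mem_closure_iff_nhds.1 hfrcl _ hboxE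
    obtain ⟨p, hp, rfl⟩ := hwE
    by_cases hpP : p ∈ P
    · exact h1 p hpP hwW
    by_cases hpN : p ∈ N
    · exact h2 p hpN hwW
    · have h3 : E ⁻¹' W ∈ 𝓝 p := (E.continuousAt (hbox p hp).2).preimage_mem_nhds (hW.mem_nhds hwW)
      obtain ⟨q, hq, hqP⟩ := mem_closure_iff_nhds.1 (hPcl p hp (hzero p hp hpP hpN)) _ h3
      exact h1 q hqP hq
  have hPL : ∀ p ∈ P, E p ∉ L := fun p hp h => hP0 p hp ((hbox p (hPb hp)).1 h)
  have hNL : ∀ p ∈ N, E p ∉ L := fun p hp h => hN0 p hp ((hbox p (hNb hp)).1 h)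
  have onside : ∀ V V' : Set (ℝ × ℝ), V ⊆ box → V' ⊆ box → IsOpen V' →
      (∀ p ∈ box, p.1 = 0 → p ∈ closure V) → (∀ p ∈ box, p.1 = 0 → p ∈ closure V') →
      (∀ p ∈ V, E p ∈ W) → (∀ p ∈ V', E p ∉ W) →
      ∀ p ∈ box, p.1 = 0 → E p ∈ frontier (closure W) := by
    intro V V' hV hV' hVo' hcl hcl' hin hout p hp hp0
    refine ⟨subset_closure (hclim V hV hin p hp (hcl p hp hp0)), fun hzint => ?_⟩
    have h3 : E ⁻¹' (interior (closure W)) ∈ 𝓝 p :=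
      (E.continuousAt (hbox p hp).2).preimage_mem_nhds (isOpen_interior.mem_nhds hzint)
    obtain ⟨q, hq, hqV⟩ := mem_closure_iff_nhds.1 (hcl' p hp hp0) _ h3
    have hqW : E q ∈ closure W := interior_subset hq
    obtain ⟨w, hw, hwW⟩ := mem_closure_iff_nhds.1 hqW _
      ((himo V' hV' hVo').mem_nhds (mem_image_of_mem _ hqV))
    obtain ⟨q', hq', rfl⟩ := hw
    exact hout q' hq' hwW
  have hfrbox : ∀ p ∈ box, p.1 = 0 → E p ∈ frontier (closure W) := by
    rcases dich P hPb hPc hPL with h1 | h1 <;> rcases dich N hNb hNc hNL with h2 | h2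
    · exact absurd ⟨h1, h2⟩ notboth
    · exact onside P N hPb hNb hNo hPcl hNcl h1 h2
    · exact onside N P hNb hPb hPo hNcl hPcl h2 h1
    · exact absurd ⟨h1, h2⟩ notnone
  filter_upwards [Metric.ball_mem_nhds (0 : ℝ × ℝ) hr] with p hp hp0
  refine ⟨?_, hfrbox p hp hp0⟩
  by_contra hpL
  have hT : ∀ V ⊆ box, IsPreconnected V → p ∈ closure V → IsPreconnected (insert p V) :=
    fun V _ hV hpV => hV.subset_closure (subset_insert _ _)
      (insert_subset hpV subset_closure)
  have hU : IsPreconnected (insert p P ∪ insert p N) :=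
    (hT P hPb hPc (hPcl p hp hp0)).union p (mem_insert _ _) (mem_insert _ _)
      (hT N hNb hNc (hNcl p hp hp0))
  have hUb : insert p P ∪ insert p N ⊆ box :=
    union_subset (insert_subset hp hPb) (insert_subset hp hNb)
  have hUL : ∀ q ∈ insert p P ∪ insert p N, E q ∉ L := by
    rintro q ((rfl | hq) | (rfl | hq))
    exacts [hpL, hPL q hq, hpL, hNL q hq]
  rcases dich _ hUb hU hUL with h | h
  · exact notboth ⟨fun q hq => h q (Or.inl (Or.inr hq)), fun q hq => h q (Or.inr (Or.inr hq))⟩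
  · exact notnone ⟨fun q hq => h q (Or.inl (Or.inr hq)), fun q hq => h q (Or.inr (Or.inr hq))⟩

theorem eventually_mem_outer_frontier {g : ℝ × ℝ → ℝ} {ψ : ℝ × ℝ → ℂ} (hg : ContDiff ℝ 1 g)
    (hψ : ContDiff ℝ 1 ψ) {S : Set (ℝ × ℝ)} (hS : IsCompact S) (hinj : InjOn ψ S) {x : ℝ × ℝ}
    (hx : x ∈ S) (hgS : ∀ᶠ y in 𝓝 x, y ∈ S → g y = g x) (hdg : fderiv ℝ g x ≠ 0)
    (htr : ∀ u, fderiv ℝ g x u = 0 → fderiv ℝ ψ x u = 0 → u = 0) {W : Set ℂ} (hW : IsOpen W)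
    (hWc : IsOpen ((ψ '' S)ᶜ \ W))
    (hfr : ψ x ∈ frontier (closure W)) :
    ∀ᶠ y in 𝓝 x, g y = g x → y ∈ S ∧ ψ y ∈ frontier (closure W) := by
  obtain ⟨⟨k, E₁, hx₁, hE₁⟩, a, E₂, hx₂, hE₂⟩ := exists_level_charts hg hψ hdg htr
  have hE₁x : E₁ x = 0 := by rw [hE₁]; simp
  have hE₂x : E₂ x = ψ x := by rw [hE₂]; simp
  have hsymm0 : E₁.symm 0 = x := by rw [← hE₁x, E₁.left_inv hx₁]
  have h0t : (0 : ℝ × ℝ) ∈ E₁.target := hE₁x ▸ E₁.map_source hx₁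
  have hnear : ∀ᶠ y in 𝓝 x, E₂ y ∈ ψ '' S → y ∈ S ∧ g y = g x := by
    have h1 := eventually_mem_of_image_near hS hψ.continuous.continuousOn hinj hx
      (V := {y | (y ∈ S → g y = g x) ∧ y ∈ E₂.source})
      (hgS.and (E₂.open_source.mem_nhds hx₂))
    have h2 : Tendsto E₂ (𝓝 x) (𝓝 (ψ x)) := hE₂x ▸ E₂.continuousAt hx₂
    filter_upwards [h2.eventually h1, E₂.open_source.mem_nhds hx₂] with y hy hys hyL
    obtain ⟨z, hz, hzy⟩ := hyL
    obtain ⟨hz1, hz2⟩ := hy z hz hzy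
    have h3 : E₂ z = E₂ y := by
      rw [← hzy, hE₂ z, hz1 hz]; simp
    have h4 := E₂.injOn hz2 hys h3
    subst h4
    exact ⟨hz, hz1 hz⟩
  have hsymm : Tendsto E₁.symm (𝓝 0) (𝓝 x) := by
    have := E₁.continuousAt_symm h0t
    rwa [ContinuousAt, hsymm0] at this
  have hcoord : ∀ᶠ p in 𝓝 (0 : ℝ × ℝ), g (E₁.symm p) - g x = p.1 := by
    filter_upwards [E₁.open_target.mem_nhds h0t] with p hp
    have := E₁.right_inv hp
    rw [hE₁] at this
    exact congrArg Prod.fst this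
  have key := flat_separation hW hWc (E₁.symm.trans E₂) (by simp [h0t, hsymm0, hx₂])
    (by
      filter_upwards [hsymm.eventually hnear, hcoord] with p hp hpc hpL
      rw [← hpc, (hp hpL).2, sub_self]) (by simpa [hsymm0, hE₂x] using hfr)
  have hE₁lim : Tendsto E₁ (𝓝 x) (𝓝 0) := hE₁x ▸ E₁.continuousAt hx₁
  filter_upwards [hE₁lim.eventually key, E₁.open_source.mem_nhds hx₁, hnear] with y hy hys hyn hgy
  have h1 : (E₁.symm.trans E₂) (E₁ y) = ψ y := by
    simp [E₁.left_inv hys, hE₂, hgy]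
  have h2 := hy (by rw [hE₁, hgy, sub_self])
  rw [h1] at h2
  have h3 : E₂ y = ψ y := by rw [hE₂, hgy]; simp
  exact ⟨(hyn (h3 ▸ h2.1)).1, h2.2⟩

/-- The points off `f '' K` at which `f - c` is not invertible. -/
def badSet {E : Type*} (A : Subalgebra ℂ (E → ℂ)) (K : Set E) (f : E → ℂ) : Set ℂ :=
  {c | c ∉ f '' K ∧ ¬InvOn A K (fun x => f x - c)}

theorem sub_const_mem {E : Type*} {A : Subalgebra ℂ (E → ℂ)} {f : E → ℂ} (hf : f ∈ A) (c : ℂ) :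
    (fun x => f x - c) ∈ A :=
  sub_mem hf (A.algebraMap_mem c)

theorem invOn_sub_const_iff {E : Type*} [TopologicalSpace E] {A : Subalgebra ℂ (E → ℂ)}
    {K : Set E} (hK : IsCompact K) {f : E → ℂ} (hf : ContinuousOn f K) (hfA : f ∈ A)
    {s : Set ℂ} (hs : IsPreconnected s) (hsK : Disjoint s (f '' K)) {c d : ℂ} (hc : c ∈ s)
    (hd : d ∈ s) : InvOn A K (fun x => f x - c) ↔ InvOn A K (fun x => f x - d) := by
  have key : ∀ {c d : ℂ}, c ∈ s → d ∈ s → InvOn A K (fun x => f x - c) →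
      InvOn A K (fun x => f x - d) := fun {c d} hc hd h => by
    refine InvOn.of_preconnected hK hs (F := fun c x => f x - c)
      (fun t _ => sub_const_mem hfA t) ?_ (fun t ht x hx h0 => ?_) hc hd h
    · exact (hf.comp continuousOn_snd fun p hp => hp.2).sub continuousOn_fst
    · exact disjoint_left.1 hsK ht ⟨x, hx, sub_eq_zero.1 h0⟩
  exact ⟨key hc hd, key hd hc⟩

theorem isOpen_badSet {E : Type*} [TopologicalSpace E] {A : Subalgebra ℂ (E → ℂ)}
    {K : Set E} (hK : IsCompact K) {f : E → ℂ} (hf : ContinuousOn f K) (hfA : f ∈ A) :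
    IsOpen (badSet A K f) ∧ IsOpen ((f '' K)ᶜ \ badSet A K f) := by
  have hloc : ∀ c ∉ f '' K, ∃ r > 0, Metric.ball c r ⊆ (f '' K)ᶜ ∧ ∀ d ∈ Metric.ball c r,
      (d ∈ badSet A K f ↔ c ∈ badSet A K f) := fun c hc => by
    obtain ⟨r, hr, hb⟩ := Metric.isOpen_iff.1 (hK.image_of_continuousOn hf).isClosed.isOpen_compl
      c hc
    refine ⟨r, hr, hb, fun d hd => and_congr (iff_of_true (hb hd) hc) (not_congr ?_)⟩
    exact invOn_sub_const_iff hK hf hfA (convex_ball c r).isPreconnected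
      (disjoint_left.2 fun _ h => hb h) hd (Metric.mem_ball_self hr)
  constructor
  · refine Metric.isOpen_iff.2 fun c hc => ?_
    obtain ⟨r, hr, -, hb⟩ := hloc c hc.1
    exact ⟨r, hr, fun d hd => (hb d hd).2 hc⟩
  · refine Metric.isOpen_iff.2 fun c hc => ?_
    obtain ⟨r, hr, hb', hb⟩ := hloc c hc.1
    exact ⟨r, hr, fun d hd => ⟨hb' hd, fun h => hc.2 ((hb d hd).1 h)⟩⟩

theorem frontier_closure_badSet {E : Type*} [TopologicalSpace E] {A : Subalgebra ℂ (E → ℂ)}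
    {K : Set E} (hK : IsCompact K) {f : E → ℂ} (hf : ContinuousOn f K) (hfA : f ∈ A)
    (hne : (badSet A K f).Nonempty) :
    (frontier (closure (badSet A K f))).Nonempty ∧
      frontier (closure (badSet A K f)) ⊆ f '' K := by
  obtain ⟨hW, hWc⟩ := isOpen_badSet hK hf hfA
  constructor
  · obtain ⟨B, hB⟩ := (hK.image_of_continuousOn hf).isBounded.exists_norm_le
    have hsub : badSet A K f ⊆ Metric.closedBall 0 (2 * max B 0) := fun c hc => by
      rw [mem_closedBall_zero_iff]
      by_contra! h
      exact hc.2 (invOn_sub_const_of_large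
        (fun x hx => (hB _ (mem_image_of_mem f hx)).trans (le_max_left _ _)) (le_max_right _ _) h)
    refine nonempty_frontier_iff.2 ⟨hne.closure, fun h => ?_⟩
    have := (Metric.isBounded_closedBall.subset hsub).closure
    rw [h] at this
    exact NormedSpace.unbounded_univ ℝ ℂ this
  · intro z hz
    by_contra hzL
    have hz' := frontier_closure_subset hz
    rw [hW.frontier_eq] at hz'
    obtain ⟨w, hw, hwW⟩ := mem_closure_iff_nhds.1 hz'.1 _ (hWc.mem_nhds ⟨hzL, hz'.2⟩)
    exact hw.2 hwW

theorem frequently_lt_of_fderiv_ne_zero {g : ℝ × ℝ → ℝ} {x : ℝ × ℝ}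
    (hdg : fderiv ℝ g x ≠ 0) :
    (∃ᶠ y in 𝓝 x, g x < g y) ∧ ∃ᶠ y in 𝓝 x, g y < g x := by
  constructor
  · intro h
    exact hdg (IsLocalMax.fderiv_eq_zero (h.mono fun y hy => not_lt.1 hy))
  · intro h
    exact hdg (IsLocalMin.fderiv_eq_zero (h.mono fun y hy => not_lt.1 hy))

/-- Polynomial convexity of the fibres, in terms of invertibility. -/
theorem invOn_fibre {g : ℝ × ℝ → ℝ} {ψ : ℝ × ℝ → ℂ} (hg : ContDiff ℝ 1 g)
    (hψ : ContDiff ℝ 1 ψ) {S : Set (ℝ × ℝ)} (hS : IsCompact S)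
    (hSQ : S ⊆ Metric.closedBall 0 1) (hinj : InjOn ψ S)
    (hgS : ∀ x ∈ S, ∀ᶠ y in 𝓝 x, y ∈ S → g y = g x)
    (hdg : ∀ x ∈ Metric.closedBall (0 : ℝ × ℝ) 1, fderiv ℝ g x ≠ 0)
    (htr : ∀ x ∈ Metric.closedBall (0 : ℝ × ℝ) 1, ∀ u, fderiv ℝ g x u = 0 →
      fderiv ℝ ψ x u = 0 → u = 0) {c : ℂ} (hc : c ∉ ψ '' S) :
    InvOn polyAlg (ψ '' S) (fun w => w - c) := by
  by_contra hbad
  set L := ψ '' S with hL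
  have hLc : IsCompact L := hS.image hψ.continuous
  have hid : (id : ℂ → ℂ) ∈ polyAlg := mem_polyAlg.2 ⟨Polynomial.X, fun w => by simp⟩
  set W := badSet polyAlg L id with hWdef
  have hopen := isOpen_badSet hLc continuousOn_id hid
  rw [image_id] at hopen
  obtain ⟨hfne, hfL⟩ := frontier_closure_badSet hLc continuousOn_id hid
    ⟨c, by rwa [image_id], hbad⟩
  rw [image_id] at hfL
  obtain ⟨w₁, hw₁⟩ := hfne
  obtain ⟨x₁, hx₁, rfl⟩ := hfL hw₁
  set M : Set (ℝ × ℝ) := S ∩ (ψ ⁻¹' frontier (closure W) ∩ g ⁻¹' {g x₁}) with hM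
  have hMc : IsCompact M := hS.inter_right
    ((isClosed_frontier.preimage hψ.continuous).inter (isClosed_singleton.preimage hg.continuous))
  have hfreq := fun x hx => frequently_lt_of_fderiv_ne_zero (hdg x hx)
  refine no_compact_open_level_piece hg.continuous (fun x hx => (hfreq x hx).1)
    (fun x hx => (hfreq x hx).2) hMc ⟨x₁, hx₁, hw₁, rfl⟩ (inter_subset_left.trans hSQ)
    (fun x hx => hx.2.2) fun x hx => ?_
  filter_upwards [eventually_mem_outer_frontier hg hψ hS hinj hx.1 (hgS x hx.1) (hdg x (hSQ hx.1))
    (htr x (hSQ hx.1)) hopen.1 hopen.2 hx.2.1] with y hy hgy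
  have hgx : g x = g x₁ := hx.2.2
  exact ⟨(hy (hgy.trans hgx.symm)).1, (hy (hgy.trans hgx.symm)).2, hgy⟩

theorem exists_contDiff_extension {E F : Type*} [NormedAddCommGroup E] [NormedSpace ℝ E]
    [FiniteDimensional ℝ E] [NormedAddCommGroup F] [NormedSpace ℝ F] {n : ℕ∞} {K U : Set E}
    (hK : IsCompact K) (hU : IsOpen U) (hKU : K ⊆ U) {f : E → F} (hf : ContDiffOn ℝ n f U) :
    ∃ f' : E → F, ContDiff ℝ n f' ∧ HasCompactSupport f' ∧ ∀ᶠ x in 𝓝ˢ K, f' x = f x := by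
  obtain ⟨T, hT, hKT, hTU⟩ := exists_compact_between hK hU hKU
  obtain ⟨χ, hχ1, hχ0, -⟩ := exists_contMDiffMap_one_nhds_of_subset_interior (n := n)
    (modelWithCornersSelf ℝ E) hK.isClosed hKT
  have hχ : ContDiff ℝ n χ := χ.contMDiff.contDiff
  refine ⟨fun x => χ x • f x, contDiff_iff_contDiffAt.2 fun x => ?_,
    HasCompactSupport.intro hT fun x hx => by simp [hχ0 x hx], ?_⟩
  · by_cases hx : x ∈ U
    · exact hχ.contDiffAt.smul (hf.contDiffAt (hU.mem_nhds hx))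
    · refine (contDiffAt_const (c := (0 : F))).congr_of_eventuallyEq ?_
      filter_upwards [hT.isClosed.isOpen_compl.mem_nhds fun h => hx (hTU h)] with y hy
      simp [hχ0 y hy]
  · filter_upwards [hχ1] with x hx
    simp [hx]

theorem contDiff_one_intervalIntegral {E : Type*} [NormedAddCommGroup E] [NormedSpace ℝ E]
    [FiniteDimensional ℝ E] {G : E × ℝ → ℝ} (hG : ContDiff ℝ 1 G) :
    ContDiff ℝ 1 fun x => ∫ s in (0 : ℝ)..1, G (x, s) := by
  set F' : E → ℝ → E →L[ℝ] ℝ := fun x s =>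
    (fderiv ℝ G (x, s)).comp (ContinuousLinearMap.inl ℝ E ℝ) with hF'
  have hF'c : Continuous (Function.uncurry F') :=
    (hG.continuous_fderiv one_ne_zero).clm_comp continuous_const
  refine contDiff_one_iff_hasFDerivAt.2 ⟨fun x => ∫ s in (0 : ℝ)..1, F' x s,
    intervalIntegral.continuous_parametric_intervalIntegral_of_continuous' hF'c 0 1, fun x => ?_⟩
  obtain ⟨C, hC⟩ := ((isCompact_closedBall x 1).prod isCompact_Icc).exists_bound_of_continuousOn
    (s := Metric.closedBall x 1 ×ˢ Icc (0 : ℝ) 1) hF'c.continuousOn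
  refine intervalIntegral.hasFDerivAt_integral_of_dominated_of_fderiv_le (bound := fun _ => C)
    (F' := F') (Metric.closedBall_mem_nhds x one_pos) ?_ ?_ ?_ ?_ ?_ ?_
  · exact Eventually.of_forall fun y => (hG.continuous.comp (by fun_prop)).aestronglyMeasurable
  · exact (hG.continuous.comp (by fun_prop : Continuous fun s : ℝ => (x, s))).intervalIntegrable _ _
  · exact (hF'c.comp (by fun_prop : Continuous fun s : ℝ => (x, s))).aestronglyMeasurable
  · refine Eventually.of_forall fun s hs y hy => hC (y, s) ⟨hy, ?_⟩
    rw [uIoc_of_le zero_le_one] at hs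
    exact ⟨hs.1.le, hs.2⟩
  · exact intervalIntegrable_const
  · refine Eventually.of_forall fun s _ y _ => ?_
    exact ((hG.differentiable one_ne_zero (y, s)).hasFDerivAt).comp y (hasFDerivAt_prodMk_left y s)

theorem exists_integral_curve {v : ℂ → ℂ} (hv : ContDiff ℝ 1 v) (hvc : HasCompactSupport v)
    (z : ℂ) {T : ℝ} (hT : 0 ≤ T) :
    ∃ γ : ℝ → ℂ, γ 0 = z ∧ ContinuousOn γ (Icc (-T) T) ∧
      ∀ t ∈ Ioo (-T) T, HasDerivAt γ (v (γ t)) t := by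
  obtain ⟨C, hC⟩ := ContDiff.lipschitzWith_of_hasCompactSupport hvc hv one_ne_zero
  obtain ⟨B, hB⟩ := hvc.exists_bound_of_continuous hv.continuous
  have hB0 : 0 ≤ B := (norm_nonneg _).trans (hB 0)
  have hPL : IsPicardLindelof (fun _ => v) (tmin := -T) (tmax := T) ⟨0, by simpa using hT, hT⟩ z
      (B.toNNReal * T.toNNReal) 0 B.toNNReal C := by
    refine IsPicardLindelof.of_time_independent (fun x _ => ?_) hC.lipschitzOnWith ?_
    · rw [Real.coe_toNNReal _ hB0]; exact hB x
    · simp [hB0, hT]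
  obtain ⟨γ, h0, hγ⟩ := hPL.exists_eq_forall_mem_Icc_hasDerivWithinAt₀
  exact ⟨γ, h0, fun t ht => (hγ t ht).continuousWithinAt,
    fun t ht => (hγ t (Ioo_subset_Icc_self ht)).hasDerivAt (Icc_mem_nhds ht.1 ht.2)⟩

theorem vectorField_ne_zero_of_integral_curve {v : ℂ → ℂ} (hv : ContDiff ℝ 1 v)
    (hvc : HasCompactSupport v) {γ : ℝ → ℂ} {T : ℝ} (hc : ContinuousOn γ (Icc (-T) T))
    (hγ : ∀ t ∈ Ioo (-T) T, HasDerivAt γ (v (γ t)) t) (h0 : v (γ 0) ≠ 0) {t : ℝ}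
    (ht : t ∈ Ioo (-T) T) : v (γ t) ≠ 0 := by
  intro hvt
  obtain ⟨C, hC⟩ := ContDiff.lipschitzWith_of_hasCompactSupport hvc hv one_ne_zero
  have h := ODE_solution_unique_of_mem_Icc (v := fun _ => v) (s := fun _ => univ) (K := C)
    (g := fun _ => γ t) (fun _ _ => hC.lipschitzOnWith) ht hc hγ (fun _ _ => mem_univ _)
    continuousOn_const (fun s _ => by simpa only [hvt] using hasDerivAt_const s (γ t))
    (fun _ _ => mem_univ _) rfl
  have h1 := h (show (0 : ℝ) ∈ Icc (-T) T from ⟨by linarith [ht.1, ht.2], by linarith [ht.1, ht.2]⟩)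
  exact h0 (by rw [h1]; exact hvt)

theorem exists_uniform_injectivity {γ γ' : ℝ → ℂ} {I U : Set ℝ} (hI : IsCompact I)
    (hU : IsOpen U) (hIU : I ⊆ U) (hγ : ∀ t ∈ U, HasDerivAt γ (γ' t) t)
    (hγ' : ContinuousOn γ' U) (h0 : ∀ t ∈ I, γ' t ≠ 0) :
    ∃ ε > 0, ∀ s ∈ I, ∀ t, s ≠ t → |s - t| < ε → γ s ≠ γ t := by
  have hloc : ∀ t ∈ I, ∃ r > 0, InjOn γ (Metric.ball t r) := fun t ht => by
    have hUt := hU.mem_nhds (hIU ht)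
    have hs : HasStrictDerivAt γ (γ' t) t := hasStrictDerivAt_of_hasDerivAt_of_continuousAt
      (by filter_upwards [hUt] with y hy using hγ y hy) (hγ'.continuousAt hUt)
    have hpos : 0 < ‖γ' t‖ / 2 := half_pos (norm_pos_iff.2 (h0 t ht))
    have h1 := hs.isLittleO.def hpos
    obtain ⟨r, hr, hball⟩ := Metric.eventually_nhds_iff_ball.1 h1
    refine ⟨r, hr, fun a ha b hb hab => ?_⟩
    have h2 := hball (a, b) (by rw [← ball_prod_same]; exact ⟨ha, hb⟩)
    simp only [hab, sub_self, zero_sub, norm_neg, ContinuousLinearMap.toSpanSingleton_apply,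
      norm_smul] at h2
    by_contra hne
    have h3 : 0 < ‖a - b‖ := norm_pos_iff.2 (sub_ne_zero.2 hne)
    nlinarith
  choose! r hr hinj using hloc
  obtain ⟨ε, hε, h⟩ := lebesgue_number_lemma_of_metric (ι := I) (c := fun t => Metric.ball t.1 (r t))
    hI (fun _ => Metric.isOpen_ball)
    fun t ht => mem_iUnion.2 ⟨⟨t, ht⟩, Metric.mem_ball_self (hr t ht)⟩
  refine ⟨ε, hε, fun s hs t hst hlt heq => hst ?_⟩
  obtain ⟨i, hi⟩ := h s hs
  refine hinj i i.2 (hi (Metric.mem_ball_self hε)) (hi ?_) heq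
  rwa [Metric.mem_ball, dist_comm, Real.dist_eq]

/-- The gradient of `h`, as a complex number. -/
def grad (h : ℂ → ℝ) (z : ℂ) : ℂ := ⟨fderiv ℝ h z 1, fderiv ℝ h z Complex.I⟩

theorem fderiv_eq_grad (h : ℂ → ℝ) (z w : ℂ) :
    fderiv ℝ h z w = (grad h z).re * w.re + (grad h z).im * w.im := by
  have hw : w = w.re • (1 : ℂ) + w.im • Complex.I := by
    apply Complex.ext <;> simp
  conv_lhs => rw [hw]
  simp only [map_add, map_smul, grad, smul_eq_mul]
  ring

theorem grad_ne_zero {h : ℂ → ℝ} {z : ℂ} (hz : fderiv ℝ h z ≠ 0) : grad h z ≠ 0 := by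
  intro h0
  refine hz (ContinuousLinearMap.ext fun w => ?_)
  rw [fderiv_eq_grad, h0]
  simp

theorem contDiff_grad {h : ℂ → ℝ} (hsm : ContDiff ℝ (⊤ : ℕ∞) h) : ContDiff ℝ 2 (grad h) := by
  have h1 : ContDiff ℝ 2 (fderiv ℝ h) := hsm.fderiv_right (by norm_cast)
  have h2 : grad h = fun z => (fderiv ℝ h z 1 : ℂ) + fderiv ℝ h z Complex.I * Complex.I := by
    funext z
    apply Complex.ext <;> simp [grad]
  rw [h2]
  exact ((Complex.ofRealCLM.contDiff.comp (h1.clm_apply contDiff_const))).add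
    ((Complex.ofRealCLM.contDiff.comp (h1.clm_apply contDiff_const)).mul contDiff_const)

/-- A vector tangent to the level curve of `h` is a multiple of the rotated gradient. -/
theorem eq_smul_of_fderiv_eq_zero {h : ℂ → ℝ} {z w : ℂ} (hz : grad h z ≠ 0)
    (hw : fderiv ℝ h z w = 0) :
    w = fderiv ℝ h z (-Complex.I * w) • ((Complex.normSq (grad h z))⁻¹ • (Complex.I * grad h z)) := by
  have hn : Complex.normSq (grad h z) ≠ 0 := by simpa using hz
  rw [smul_smul, ← div_eq_mul_inv]
  rw [fderiv_eq_grad] at hw ⊢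
  rw [Complex.normSq_apply, ← sq, ← sq] at hn ⊢
  apply Complex.ext
  · simp only [Complex.smul_re, smul_eq_mul, Complex.mul_re, Complex.mul_im, Complex.I_re,
      Complex.I_im, Complex.neg_re, Complex.neg_im]
    field_simp
    linear_combination (grad h z).re * hw
  · simp only [Complex.smul_im, smul_eq_mul, Complex.mul_re, Complex.mul_im, Complex.I_re,
      Complex.I_im, Complex.neg_re, Complex.neg_im]
    field_simp
    linear_combination (grad h z).im * hw

theorem eqOn_fderiv_of_eqOn {F : Type*} [NormedAddCommGroup F] [NormedSpace ℝ F]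
    {u v : ℝ × ℝ → F} (hu : ContDiff ℝ 1 u) {v' : ℝ × ℝ → ℝ × ℝ →L[ℝ] F}
    (hv : ∀ x ∈ Metric.ball (0 : ℝ × ℝ) 1, HasFDerivAt v (v' x) x)
    (hv' : ContinuousOn v' (Metric.closedBall 0 1))
    (huv : EqOn u v (Metric.closedBall 0 1)) :
    EqOn (fderiv ℝ u) v' (Metric.closedBall 0 1) := by
  have h1 : EqOn (fderiv ℝ u) v' (Metric.ball 0 1) := fun x hx => by
    have he : u =ᶠ[𝓝 x] v := by
      filter_upwards [Metric.isOpen_ball.mem_nhds hx] with y hy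
        using huv (Metric.ball_subset_closedBall hy)
    rw [he.fderiv_eq, (hv x hx).fderiv]
  refine h1.of_subset_closure (hu.continuous_fderiv one_ne_zero).continuousOn hv'
    Metric.ball_subset_closedBall ?_
  rw [closure_ball _ one_ne_zero]

/-- The first component of a disc in a real curve times `ℂ` factors through the curve, with a
submersive height function. -/
theorem exists_lift {h : ℂ → ℝ} (hsm : ContDiff ℝ (⊤ : ℕ∞) h) {f ψ : ℝ × ℝ → ℂ}
    (hf : ContDiff ℝ 2 f)
    (hreg : ∀ x ∈ Metric.closedBall (0 : ℝ × ℝ) 1, h (f x) = 0 ∧ grad h (f x) ≠ 0)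
    (hinj : ∀ x ∈ Metric.closedBall (0 : ℝ × ℝ) 1, ∀ u, fderiv ℝ f x u = 0 →
      fderiv ℝ ψ x u = 0 → u = 0)
    (htr : ∀ x ∈ Metric.closedBall (0 : ℝ × ℝ) 1, fderiv ℝ f x ≠ 0) :
    ∃ (g : ℝ × ℝ → ℝ) (γ : ℝ → ℂ) (R ε : ℝ), ContDiff ℝ 1 g ∧ 0 < R ∧ 0 < ε ∧ ε ≤ 1 ∧
      (∀ x ∈ Metric.closedBall (0 : ℝ × ℝ) 1, |g x| ≤ R) ∧
      ContinuousOn γ (Icc (-(R + 1)) (R + 1)) ∧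
      (∀ t ∈ Icc (-(R + 1)) (R + 1), h (γ t) = 0 ∧ grad h (γ t) ≠ 0) ∧
      (∀ s ∈ Icc (-(R + 1)) (R + 1), ∀ t, s ≠ t → |s - t| < ε → γ s ≠ γ t) ∧
      (∀ x ∈ Metric.closedBall (0 : ℝ × ℝ) 1, f x = γ (g x)) ∧
      (∀ x ∈ Metric.closedBall (0 : ℝ × ℝ) 1, fderiv ℝ g x ≠ 0) ∧
      ∀ x ∈ Metric.closedBall (0 : ℝ × ℝ) 1, ∀ u, fderiv ℝ g x u = 0 →
        fderiv ℝ ψ x u = 0 → u = 0 := by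
  set Q := Metric.closedBall (0 : ℝ × ℝ) 1 with hQ
  have hQc : IsCompact Q := isCompact_closedBall _ _
  have h0Q : (0 : ℝ × ℝ) ∈ Q := Metric.mem_closedBall_self zero_le_one
  have hgr := contDiff_grad hsm
  have hf1 : ContDiff ℝ 1 f := hf.of_le one_le_two
  have hfd : ∀ x, HasFDerivAt f (fderiv ℝ f x) x := fun x =>
    (hf1.differentiable one_ne_zero x).hasFDerivAt
  have hhd : ∀ z, HasFDerivAt h (fderiv ℝ h z) z := fun z =>
    (hsm.differentiable (by simp) z).hasFDerivAt
  obtain ⟨κ, hκ, hκc, hκeq⟩ := exists_contDiff_extension (n := 1) (hQc.image hf.continuous)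
    (isOpen_ne_fun hgr.continuous continuous_const)
    (by rintro _ ⟨x, hx, rfl⟩; exact (hreg x hx).2)
    (f := fun z => (Complex.normSq (grad h z))⁻¹) (U := {z | grad h z ≠ 0}) (by
      have h1 : ContDiff ℝ 1 fun z => Complex.normSq (grad h z) := by
        simp only [Complex.normSq_apply]
        have h2 : ContDiff ℝ 1 (grad h) := hgr.of_le one_le_two
        have h3 := Complex.reCLM.contDiff.comp h2
        have h4 := Complex.imCLM.contDiff.comp h2
        exact (h3.mul h3).add (h4.mul h4)
      exact h1.contDiffOn.inv fun z hz => by simpa using hz)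
  set v : ℂ → ℂ := fun z => κ z • (Complex.I * grad h z) with hv
  have hv1 : ContDiff ℝ 1 v := hκ.smul (contDiff_const.mul (hgr.of_le one_le_two))
  have hvc : HasCompactSupport v := hκc.smul_right
  have hvn : ∀ z, v z ≠ 0 → grad h z ≠ 0 := fun z hz h0 => hz (by simp [hv, h0])
  have hκQ : ∀ x ∈ Q, κ (f x) = (Complex.normSq (grad h (f x)))⁻¹ := fun x hx =>
    hκeq.self_of_nhdsSet _ (mem_image_of_mem f hx)
  have hvQ : ∀ x ∈ Q, v (f x) ≠ 0 := fun x hx => by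
    have := (hreg x hx).2
    simp [hv, hκQ x hx, this]
  have hhv : ∀ z, fderiv ℝ h z (v z) = 0 := fun z => by
    rw [fderiv_eq_grad]
    simp [hv]
    ring
  set ρ : ℝ × ℝ → ℝ × ℝ →L[ℝ] ℝ := fun x =>
    (fderiv ℝ h (f x)).comp ((ContinuousLinearMap.mul ℝ ℂ (-Complex.I)).comp (fderiv ℝ f x)) with hρ
  have hρ1 : ContDiff ℝ 1 ρ := by
    have h1 : ContDiff ℝ 1 (fderiv ℝ h) := hsm.fderiv_right (by norm_cast)
    exact (h1.comp hf1).clm_comp (contDiff_const.clm_comp (hf.fderiv_right (by norm_num)))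
  have hdf : ∀ x ∈ Q, ∀ u, fderiv ℝ f x u = ρ x u • v (f x) := by
    have h1 : EqOn (fderiv ℝ fun _ : ℝ × ℝ => (0 : ℝ))
        (fun x => (fderiv ℝ h (f x)).comp (fderiv ℝ f x)) Q := by
      refine eqOn_fderiv_of_eqOn contDiff_const (v := h ∘ f)
        (fun x _ => (hhd _).comp x (hfd x)) ?_ (fun x hx => (hreg x hx).1.symm)
      exact (((hsm.continuous_fderiv (by simp)).comp hf.continuous).clm_comp
        (hf1.continuous_fderiv one_ne_zero)).continuousOn
    intro x hx u
    have h2 : fderiv ℝ h (f x) (fderiv ℝ f x u) = 0 := by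
      have := congrArg (fun A => A u) (h1 hx)
      simpa using this.symm
    have h3 := eq_smul_of_fderiv_eq_zero (hreg x hx).2 h2
    rw [← hκQ x hx] at h3
    exact h3
  set g : ℝ × ℝ → ℝ := fun x => ∫ s in (0 : ℝ)..1, ρ (s • x) x with hg
  have hg1 : ContDiff ℝ 1 g := contDiff_one_intervalIntegral
    (G := fun p : (ℝ × ℝ) × ℝ => ρ (p.2 • p.1) p.1)
    ((hρ1.comp (contDiff_snd.smul contDiff_fst)).clm_apply contDiff_fst)
  have hgray : ∀ x, ∀ s : ℝ, HasDerivAt (fun s : ℝ => g (s • x)) (ρ (s • x) x) s := fun x s => by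
    have hcont : Continuous fun r : ℝ => ρ (r • x) x :=
      (hρ1.continuous.comp (by fun_prop)).clm_apply continuous_const
    have h1 : (fun s : ℝ => g (s • x)) = fun s => ∫ r in (0 : ℝ)..s, ρ (r • x) x := by
      funext s
      have h2 := intervalIntegral.smul_integral_comp_mul_right (a := 0) (b := 1)
        (fun r : ℝ => ρ (r • x) x) s
      simp only [zero_mul, one_mul] at h2
      rw [← h2, ← intervalIntegral.integral_smul]
      simp only [hg, smul_smul, map_smul]
    rw [h1]
    exact intervalIntegral.integral_hasDerivAt_right (hcont.intervalIntegrable _ _)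
      (hcont.stronglyMeasurableAtFilter _ _) hcont.continuousAt
  obtain ⟨R₀, hR₀⟩ := hQc.exists_bound_of_continuousOn hg1.continuous.continuousOn
  set R := max R₀ 1 with hR
  have hR0 : 0 < R := lt_max_of_lt_right one_pos
  have hgR : ∀ x ∈ Q, |g x| ≤ R := fun x hx => (hR₀ x hx).trans (le_max_left _ _)
  obtain ⟨γ, hγ0, hγc, hγ⟩ := exists_integral_curve hv1 hvc (f 0) (T := R + 2) (by linarith)
  have hsub : Icc (-(R + 1)) (R + 1) ⊆ Ioo (-(R + 2)) (R + 2) := fun t ht =>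
    ⟨by linarith [ht.1], by linarith [ht.2]⟩
  have hvγ : ∀ t ∈ Ioo (-(R + 2)) (R + 2), v (γ t) ≠ 0 := fun t ht =>
    vectorField_ne_zero_of_integral_curve hv1 hvc hγc hγ (by rw [hγ0]; exact hvQ 0 h0Q) ht
  have hγc' : ContinuousOn γ (Ioo (-(R + 2)) (R + 2)) := hγc.mono Ioo_subset_Icc_self
  obtain ⟨ε, hε, hγinj⟩ := exists_uniform_injectivity (γ := γ) isCompact_Icc isOpen_Ioo hsub hγ
    (hv1.continuous.comp_continuousOn hγc') fun t ht => hvγ t (hsub ht)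
  have hhγ : ∀ t ∈ Ioo (-(R + 2)) (R + 2), h (γ t) = 0 := by
    have h1 : ∀ t ∈ Ioo (-(R + 2)) (R + 2), HasDerivAt (h ∘ γ) 0 t := fun t ht => by
      have := (hhd (γ t)).comp_hasDerivAt t (hγ t ht)
      rwa [hhv] at this
    intro t ht
    have h2 := isOpen_Ioo.is_const_of_deriv_eq_zero (convex_Ioo _ _).isPreconnected
      (fun s hs => (h1 s hs).differentiableAt.differentiableWithinAt) (fun s hs => (h1 s hs).deriv)
      ht (show (0 : ℝ) ∈ Ioo (-(R + 2)) (R + 2) from ⟨by linarith, by linarith⟩)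
    simp only [Function.comp_apply, hγ0, (hreg 0 h0Q).1] at h2
    exact h2
  have hgI : ∀ x ∈ Q, g x ∈ Ioo (-(R + 2)) (R + 2) := fun x hx =>
    ⟨by linarith [(abs_le.1 (hgR x hx)).1], by linarith [(abs_le.1 (hgR x hx)).2]⟩
  have hfγ : ∀ x ∈ Q, f x = γ (g x) := by
    intro x hx
    obtain ⟨C, hC⟩ := ContDiff.lipschitzWith_of_hasCompactSupport hvc hv1 one_ne_zero
    have hsx : ∀ s ∈ Icc (0 : ℝ) 1, s • x ∈ Q := fun s hs => by
      rw [hQ, mem_closedBall_zero_iff] at hx ⊢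
      rw [norm_smul, Real.norm_eq_abs, abs_of_nonneg hs.1]
      exact mul_le_one₀ hs.2 (norm_nonneg _) hx
    have hcont : Continuous fun r : ℝ => ρ (r • x) x :=
      (hρ1.continuous.comp (by fun_prop)).clm_apply continuous_const
    obtain ⟨B, hB⟩ := (isCompact_Icc (a := (0 : ℝ)) (b := 1)).exists_bound_of_continuousOn
      hcont.continuousOn
    have hd1 : ∀ s ∈ Icc (0 : ℝ) 1,
        HasDerivAt (fun s : ℝ => f (s • x)) (ρ (s • x) x • v (f (s • x))) s := fun s hs => by
      rw [← hdf _ (hsx s hs)]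
      have h1 : HasDerivAt (fun s : ℝ => s • x) x s := by
        simpa using (hasDerivAt_id s).smul_const x
      exact (hfd (s • x)).comp_hasDerivAt s h1
    have hd2 : ∀ s ∈ Icc (0 : ℝ) 1,
        HasDerivAt (fun s : ℝ => γ (g (s • x))) (ρ (s • x) x • v (γ (g (s • x)))) s :=
      fun s hs => (hγ _ (hgI _ (hsx s hs))).scomp s (hgray x s)
    have heq := ODE_solution_unique_of_mem_Icc_right
      (v := fun s y => ρ (s • x) x • v y) (s := fun _ => univ) (K := B.toNNReal * C)
      (a := 0) (b := 1) (f := fun s : ℝ => f (s • x)) (g := fun s : ℝ => γ (g (s • x)))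
      (fun s hs => (LipschitzWith.of_dist_le_mul fun y z => by
        rw [dist_smul₀, NNReal.coe_mul, mul_assoc]
        exact mul_le_mul ((hB s (Ico_subset_Icc_self hs)).trans (Real.le_coe_toNNReal B))
          (hC.dist_le_mul y z) dist_nonneg NNReal.zero_le_coe).lipschitzOnWith)
      (fun s hs => (hd1 s hs).continuousAt.continuousWithinAt)
      (fun s hs => (hd1 s (Ico_subset_Icc_self hs)).hasDerivWithinAt) (fun _ _ => mem_univ _)
      (fun s hs => (hd2 s hs).continuousAt.continuousWithinAt)
      (fun s hs => (hd2 s (Ico_subset_Icc_self hs)).hasDerivWithinAt) (fun _ _ => mem_univ _)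
      (by simp [hg, hγ0])
    simpa using heq (right_mem_Icc.2 zero_le_one)
  have hdg : ∀ x ∈ Q, ∀ u, fderiv ℝ f x u = fderiv ℝ g x u • v (f x) := by
    have h1 := eqOn_fderiv_of_eqOn hf1 (v := γ ∘ g)
      (v' := fun x => (fderiv ℝ g x).smulRight (v (f x))) (fun x hx => by
        have hxQ := Metric.ball_subset_closedBall hx
        have := (hγ _ (hgI x hxQ)).hasFDerivAt.comp x
          (hg1.differentiable one_ne_zero x).hasFDerivAt
        rw [← hfγ x hxQ] at this
        exact this) (by
        have h2 := hg1.continuous_fderiv one_ne_zero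
        have h3 := hv1.continuous.comp hf.continuous
        exact ((ContinuousLinearMap.smulRightL ℝ (ℝ × ℝ) ℂ).continuous₂.comp
          (h2.prodMk h3)).continuousOn) hfγ
    intro x hx u
    rw [h1 hx]
    rfl
  refine ⟨g, γ, R, min ε 1, hg1, hR0, lt_min hε one_pos, min_le_right _ _, hgR,
    hγc'.mono hsub, fun t ht => ⟨hhγ t (hsub ht), hvn _ (hvγ t (hsub ht))⟩,
    fun s hs t hst hlt => hγinj s hs t hst (hlt.trans_le (min_le_left _ _)), hfγ,
    fun x hx h0 => htr x hx (ContinuousLinearMap.ext fun u => ?_),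
    fun x hx u hu hψu => hinj x hx u ?_ hψu⟩
  · rw [hdg x hx, h0]; simp
  · rw [hdg x hx, hu, zero_smul]

/-- Moving off the zero set of `h` in a direction close to the gradient changes the sign of `h`. -/
theorem eventually_sign_of_push {h : ℂ → ℝ} (hsm : ContDiff ℝ (⊤ : ℕ∞) h) {z₀ : ℂ}
    (h0 : grad h z₀ ≠ 0) :
    ∀ᶠ p : ℂ × ℝ in 𝓝 (z₀, 0), h p.1 = 0 → 0 < p.2 → ∀ ζ : ℂ, ‖ζ - 1‖ ≤ 1 / 4 →
      0 < h (p.1 + p.2 * grad h p.1 * ζ) ∧ h (p.1 - p.2 * grad h p.1 * ζ) < 0 := by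
  set m := ‖grad h z₀‖ with hm
  have hm0 : 0 < m := norm_pos_iff.2 h0
  have hs := (hsm.contDiffAt (x := z₀)).hasStrictFDerivAt (by simp)
  obtain ⟨r, hr, hball⟩ := Metric.eventually_nhds_iff_ball.1
    (hs.isLittleO.def (c := m / 4) (by positivity))
  have hball' : ∀ a b, ‖a - z₀‖ < r → ‖b - z₀‖ < r →
      |h a - h b - fderiv ℝ h z₀ (a - b)| ≤ m / 4 * ‖a - b‖ := fun a b ha hb =>
    hball (a, b) (by rw [← ball_prod_same]; exact ⟨mem_ball_iff_norm.2 ha, mem_ball_iff_norm.2 hb⟩)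
  have e1 : ∀ᶠ p : ℂ × ℝ in 𝓝 (z₀, 0), ‖grad h p.1 - grad h z₀‖ < m / 16 := by
    have hc : ContinuousAt (fun p : ℂ × ℝ => ‖grad h p.1 - grad h z₀‖) (z₀, 0) :=
      (((contDiff_grad hsm).continuous.comp continuous_fst).sub continuous_const).norm.continuousAt
    exact hc.eventually_lt_const (by simpa using by positivity)
  have e2 : ∀ᶠ p : ℂ × ℝ in 𝓝 (z₀, 0), ‖p.1 - z₀‖ + |p.2| * (2 * m) < r := by
    have hc : ContinuousAt (fun p : ℂ × ℝ => ‖p.1 - z₀‖ + |p.2| * (2 * m)) (z₀, 0) := by fun_prop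
    exact hc.eventually_lt_const (by simpa using hr)
  filter_upwards [e1, e2] with p hp1 hp2 hz hτ ζ hζ
  obtain ⟨z, τ⟩ := p
  simp only at hp1 hp2 hz hτ ⊢
  rw [abs_of_pos hτ] at hp2
  set n := grad h z with hn
  set d : ℂ := τ * n * ζ with hd
  have hnn : ‖n‖ ≤ 17 / 16 * m := by
    have : ‖n‖ ≤ ‖n - grad h z₀‖ + m := by simpa using norm_add_le (n - grad h z₀) (grad h z₀)
    linarith
  have hζn : ‖ζ‖ ≤ 5 / 4 := by
    have : ‖ζ‖ ≤ ‖ζ - 1‖ + 1 := by simpa using norm_add_le (ζ - 1) 1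
    linarith
  have hdn : ‖d‖ ≤ τ * (85 / 64 * m) := by
    rw [hd, norm_mul, norm_mul, Complex.norm_real, Real.norm_eq_abs, abs_of_pos hτ, mul_assoc]
    have : ‖n‖ * ‖ζ‖ ≤ 17 / 16 * m * (5 / 4) :=
      mul_le_mul hnn hζn (norm_nonneg _) (by positivity)
    exact mul_le_mul_of_nonneg_left (by linarith) hτ.le
  have hlow : τ * (1 / 2 * m ^ 2) ≤ fderiv ℝ h z₀ d := by
    have h1 : fderiv ℝ h z₀ d = τ * (((starRingEnd ℂ) (grad h z₀)) * (n * ζ)).re := by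
      rw [fderiv_eq_grad, hd]
      simp
      ring
    have h2 : (starRingEnd ℂ) (grad h z₀) * (n * ζ) = ((m ^ 2 : ℝ) : ℂ) +
        ((m ^ 2 : ℝ) * (ζ - 1) + (starRingEnd ℂ) (grad h z₀) * ((n - grad h z₀) * ζ)) := by
      have h3 : (starRingEnd ℂ) (grad h z₀) * grad h z₀ = ((m ^ 2 : ℝ) : ℂ) := by
        rw [Complex.conj_mul', hm]; norm_cast
      linear_combination ζ * h3
    have h4 : ‖((m ^ 2 : ℝ) : ℂ) * (ζ - 1) + (starRingEnd ℂ) (grad h z₀) * ((n - grad h z₀) * ζ)‖ ≤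
        m ^ 2 * (1 / 4) + m * (m / 16 * (5 / 4)) := by
      refine (norm_add_le _ _).trans (add_le_add ?_ ?_)
      · rw [norm_mul, Complex.norm_real, Real.norm_eq_abs, abs_of_nonneg (sq_nonneg m)]
        exact mul_le_mul_of_nonneg_left hζ (sq_nonneg m)
      · rw [norm_mul, RCLike.norm_conj, norm_mul]
        exact mul_le_mul_of_nonneg_left
          (mul_le_mul hp1.le hζn (norm_nonneg _) (by positivity)) hm0.le
    rw [h1, h2, Complex.add_re, Complex.ofReal_re]
    refine mul_le_mul_of_nonneg_left ?_ hτ.le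
    have h5 := (abs_le.1 (Complex.abs_re_le_norm _)).1.trans'
      (neg_le_neg h4)
    nlinarith [sq_nonneg m]
  have hz' : ‖z - z₀‖ < r := by
    have : 0 ≤ τ * (2 * m) := by positivity
    linarith
  have hdr : ‖z - z₀‖ + ‖d‖ < r := by
    have : τ * (85 / 64 * m) ≤ τ * (2 * m) := by gcongr; norm_num
    linarith
  have hgap : m / 4 * ‖d‖ < τ * (1 / 2 * m ^ 2) := by
    have h1 : m / 4 * ‖d‖ ≤ m / 4 * (τ * (85 / 64 * m)) :=
      mul_le_mul_of_nonneg_left hdn (by positivity)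
    have h2 : 0 < τ * m ^ 2 := by positivity
    nlinarith
  constructor
  · have h1 := hball' (z + d) z (by
      rw [show z + d - z₀ = (z - z₀) + d by ring]
      exact (norm_add_le _ _).trans_lt hdr) hz'
    rw [add_sub_cancel_left, hz] at h1
    linarith [(abs_le.1 h1).1]
  · have h1 := hball' (z - d) z (by
      rw [show z - d - z₀ = (z - z₀) - d by ring]
      exact (norm_sub_le _ _).trans_lt hdr) hz'
    rw [sub_sub_cancel_left, hz, map_neg, norm_neg] at h1
    linarith [(abs_le.1 h1).2]

/-- The closed unit box, the parameter domain of the disc. -/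
abbrev box : Set (ℝ × ℝ) := Metric.closedBall 0 1

theorem isCompact_box : IsCompact box := isCompact_closedBall _ _

/-- A disc `(f, ψ)` in (regular curve) `× ℂ`, together with a factorisation `f = γ ∘ g` through a
parametrisation of the curve, and an algebra containing the coordinates. -/
structure CurveDisc (h : ℂ → ℝ) (A : Subalgebra ℂ (ℝ × ℝ → ℂ)) (f ψ : ℝ × ℝ → ℂ)
    (g : ℝ × ℝ → ℝ) (γ : ℝ → ℂ) (R ε : ℝ) : Prop where
  hsm : ContDiff ℝ (⊤ : ℕ∞) h
  f_mem : f ∈ A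
  ψ_mem : ψ ∈ A
  f_cont : Continuous f
  ψ_diff : ContDiff ℝ 1 ψ
  g_diff : ContDiff ℝ 1 g
  γ_cont : Continuous γ
  ε_pos : 0 < ε
  ε_le : ε ≤ 1
  R_pos : 0 < R
  γ_zero : ∀ t ∈ Icc (-(R + 1)) (R + 1), h (γ t) = 0
  γ_reg : ∀ t ∈ Icc (-(R + 1)) (R + 1), grad h (γ t) ≠ 0
  γ_inj : ∀ s ∈ Icc (-(R + 1)) (R + 1), ∀ t ∈ Icc (-(R + 1)) (R + 1),
    s ≠ t → |s - t| < ε → γ s ≠ γ t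
  lift : ∀ x ∈ box, f x = γ (g x)
  g_le : ∀ x ∈ box, |g x| ≤ R
  inj : ∀ x ∈ box, ∀ y ∈ box, f x = f y → ψ x = ψ y → x = y
  dg_ne : ∀ x ∈ box, fderiv ℝ g x ≠ 0
  tr : ∀ x ∈ box, ∀ u, fderiv ℝ g x u = 0 → fderiv ℝ ψ x u = 0 → u = 0

/-- The function `f - (γ σ + τ n(γ σ) H)`, where `n` is the gradient of `h`. -/
def push (h : ℂ → ℝ) (f : ℝ × ℝ → ℂ) (γ : ℝ → ℂ) (H : ℝ × ℝ → ℂ) (σ τ : ℝ) : ℝ × ℝ → ℂ :=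
  fun x => f x - γ σ - τ * grad h (γ σ) * H x

/-- `push` is invertible for all small positive `τ`. -/
def PushInv (h : ℂ → ℝ) (A : Subalgebra ℂ (ℝ × ℝ → ℂ)) (f : ℝ × ℝ → ℂ) (γ : ℝ → ℂ)
    (H : ℝ × ℝ → ℂ) (σ : ℝ) : Prop :=
  ∃ τ₀ > 0, ∀ τ, 0 < τ → τ < τ₀ → InvOn A box (push h f γ H σ τ)

/-- Near the fibre over `γ σ`, the function `H` is close to `1` or to `-1`. -/
def NearSign (f : ℝ × ℝ → ℂ) (γ : ℝ → ℂ) (H : ℝ × ℝ → ℂ) (σ δ : ℝ) : Prop :=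
  ∀ x ∈ box, ‖f x - γ σ‖ < δ → ‖H x - 1‖ < 1 / 4 ∨ ‖H x + 1‖ < 1 / 4

/-- Near the fibre over `γ σ`, the function `H` is close to `1` on the upper part of the disc and
to `-1` on the lower part. -/
def Splits (f : ℝ × ℝ → ℂ) (g : ℝ × ℝ → ℝ) (γ : ℝ → ℂ) (ε : ℝ) (H : ℝ × ℝ → ℂ) (σ δ : ℝ) : Prop :=
  ∀ x ∈ box, ‖f x - γ σ‖ < δ →
    (σ - ε / 2 ≤ g x → ‖H x - 1‖ < 1 / 4) ∧ (g x ≤ σ - ε / 2 → ‖H x + 1‖ < 1 / 4)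

theorem Splits.nearSign {f : ℝ × ℝ → ℂ} {g : ℝ × ℝ → ℝ} {γ : ℝ → ℂ} {ε : ℝ} {H : ℝ × ℝ → ℂ}
    {σ δ : ℝ} (hH : Splits f g γ ε H σ δ) : NearSign f γ H σ δ := fun x hx hfx =>
  (le_total (σ - ε / 2) (g x)).imp (hH x hx hfx).1 (hH x hx hfx).2

theorem norm_segment_lt {a b c : ℂ} {r s : ℝ} (ha : ‖a - c‖ < r) (hb : ‖b - c‖ < r)
    (hs : s ∈ Icc (0 : ℝ) 1) : ‖(1 - s) * a + s * b - c‖ < r := by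
  have h1 := (convex_ball c r) (mem_ball_iff_norm.2 ha) (mem_ball_iff_norm.2 hb)
    (a := 1 - s) (b := s) (by linarith [hs.2]) hs.1 (by ring)
  rw [mem_ball_iff_norm] at h1
  simpa using h1

theorem Splits.segment {f : ℝ × ℝ → ℂ} {g : ℝ × ℝ → ℝ} {γ : ℝ → ℂ} {ε : ℝ} {H H' : ℝ × ℝ → ℂ}
    {σ δ : ℝ} (hH : Splits f g γ ε H σ δ) (hH' : Splits f g γ ε H' σ δ) {s : ℝ}
    (hs : s ∈ Icc (0 : ℝ) 1) : Splits f g γ ε (fun x => (1 - s) * H x + s * H' x) σ δ := by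
  intro x hx hfx
  refine ⟨fun hg => norm_segment_lt ((hH x hx hfx).1 hg) ((hH' x hx hfx).1 hg) hs, fun hg => ?_⟩
  have := norm_segment_lt (c := -1) (by simpa using (hH x hx hfx).2 hg)
    (by simpa using (hH' x hx hfx).2 hg) hs
  simpa using this

namespace CurveDisc

variable {h : ℂ → ℝ} {A : Subalgebra ℂ (ℝ × ℝ → ℂ)} {f ψ : ℝ × ℝ → ℂ} {g : ℝ × ℝ → ℝ}
  {γ : ℝ → ℂ} {R ε : ℝ}

theorem g_mem (D : CurveDisc h A f ψ g γ R ε) {x : ℝ × ℝ} (hx : x ∈ box) :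
    g x ∈ Icc (-(R + 1)) (R + 1) := by
  have := abs_le.1 (D.g_le x hx)
  exact ⟨by linarith, by linarith⟩

theorem h_eq_zero (D : CurveDisc h A f ψ g γ R ε) {x : ℝ × ℝ} (hx : x ∈ box) : h (f x) = 0 := by
  rw [D.lift x hx]
  exact D.γ_zero _ (D.g_mem hx)

theorem push_mem (D : CurveDisc h A f ψ g γ R ε) {H : ℝ × ℝ → ℂ} (hH : H ∈ A) (σ τ : ℝ) :
    push h f γ H σ τ ∈ A :=
  sub_mem (sub_const_mem D.f_mem _) (mul_mem (A.algebraMap_mem (τ * grad h (γ σ))) hH)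

theorem push_ne_zero (D : CurveDisc h A f ψ g γ R ε) {σ₀ : ℝ}
    (hσ₀ : σ₀ ∈ Icc (-(R + 1)) (R + 1)) {C δ : ℝ} (hδ : 0 < δ) :
    ∃ r > 0, ∀ σ ∈ Icc (-(R + 1)) (R + 1), |σ - σ₀| < r → ∀ τ, 0 < τ → τ < r →
      ∀ H : ℝ × ℝ → ℂ, (∀ x ∈ box, ‖H x‖ ≤ C) → NearSign f γ H σ δ →
        ∀ x ∈ box, push h f γ H σ τ x ≠ 0 := by
  have hgrad : Continuous (grad h) := (contDiff_grad D.hsm).continuous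
  have e1 : ∀ᶠ p : ℝ × ℝ in 𝓝 (σ₀, 0), h (γ p.1) = 0 → 0 < p.2 → ∀ ζ : ℂ, ‖ζ - 1‖ ≤ 1 / 4 →
      0 < h (γ p.1 + p.2 * grad h (γ p.1) * ζ) ∧ h (γ p.1 - p.2 * grad h (γ p.1) * ζ) < 0 := by
    have hc : ContinuousAt (fun p : ℝ × ℝ => (γ p.1, p.2)) (σ₀, 0) :=
      ((D.γ_cont.comp continuous_fst).prodMk continuous_snd).continuousAt
    exact hc.eventually (eventually_sign_of_push D.hsm (D.γ_reg σ₀ hσ₀))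
  have e2 : ∀ᶠ p : ℝ × ℝ in 𝓝 (σ₀, 0), |p.2| * ‖grad h (γ p.1)‖ * |C| < δ := by
    have hc : ContinuousAt (fun p : ℝ × ℝ => |p.2| * ‖grad h (γ p.1)‖ * |C|) (σ₀, 0) :=
      ((continuous_snd.abs.mul
        (hgrad.comp (D.γ_cont.comp continuous_fst)).norm).mul continuous_const).continuousAt
    exact hc.eventually_lt_const (by simpa using hδ)
  obtain ⟨r, hr, hball⟩ := Metric.eventually_nhds_iff_ball.1 (e1.and e2)
  refine ⟨r, hr, fun σ hσ hσσ τ hτ hτr H hHC hH x hx hzero => ?_⟩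
  obtain ⟨h1, h2⟩ := hball (σ, τ) (by
    rw [← ball_prod_same]
    exact ⟨by rwa [Metric.mem_ball, Real.dist_eq], by
      rw [Metric.mem_ball, Real.dist_eq, sub_zero, abs_of_pos hτ]; exact hτr⟩)
  simp only at h1 h2
  have hfx : f x = γ σ + τ * grad h (γ σ) * H x := by
    rw [push, sub_sub, sub_eq_zero] at hzero
    exact hzero
  have hclose : ‖f x - γ σ‖ < δ := by
    rw [hfx, add_sub_cancel_left, norm_mul, norm_mul, Complex.norm_real, Real.norm_eq_abs]
    exact lt_of_le_of_lt (mul_le_mul_of_nonneg_left ((hHC x hx).trans (le_abs_self C))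
      (by positivity)) h2
  have hh := D.h_eq_zero hx
  rcases hH x hx hclose with h3 | h3
  · have := (h1 (D.γ_zero σ hσ) hτ _ h3.le).1
    rw [← hfx, hh] at this
    exact lt_irrefl _ this
  · have := (h1 (D.γ_zero σ hσ) hτ (-H x) (by
      rw [← norm_neg]; simpa [add_comm] using h3.le)).2
    rw [mul_neg, sub_neg_eq_add, ← hfx, hh] at this
    exact lt_irrefl _ this

theorem exists_norm_le {H : ℝ × ℝ → ℂ} (hH : Continuous H) : ∃ C, ∀ x ∈ box, ‖H x‖ ≤ C :=
  isCompact_box.exists_bound_of_continuousOn hH.continuousOn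

theorem continuous_push (D : CurveDisc h A f ψ g γ R ε) :
    Continuous fun p : ((ℝ × ℝ) × ℂ) × ℝ × ℝ =>
      f p.2 - γ p.1.1.1 - p.1.1.2 * grad h (γ p.1.1.1) * p.1.2 := by
  have h1 := D.f_cont
  have h2 := D.γ_cont
  have h3 := (contDiff_grad D.hsm).continuous
  fun_prop

theorem pushInv_iff_of_near (D : CurveDisc h A f ψ g γ R ε) {σ₀ : ℝ}
    (hσ₀ : σ₀ ∈ Icc (-(R + 1)) (R + 1)) {H : ℝ × ℝ → ℂ} (hHA : H ∈ A) (hHc : Continuous H)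
    {δ r : ℝ} (hδ : 0 < δ) (hr : 0 < r) (hH : ∀ σ, |σ - σ₀| < r → NearSign f γ H σ δ) :
    ∃ r' > 0, ∀ σ ∈ Icc (-(R + 1)) (R + 1), |σ - σ₀| < r' →
      (PushInv h A f γ H σ ↔ PushInv h A f γ H σ₀) := by
  obtain ⟨C, hC⟩ := exists_norm_le hHc
  obtain ⟨r₁, hr₁, hne⟩ := D.push_ne_zero hσ₀ (C := C) hδ
  set T : Set (ℝ × ℝ) := (Icc (-(R + 1)) (R + 1) ∩ Metric.ball σ₀ (min r r₁)) ×ˢ Ioo 0 r₁ with hT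
  have hTc : IsPreconnected T :=
    (((convex_Icc _ _).inter (convex_ball _ _)).prod (convex_Ioo _ _)).isPreconnected
  have hrr : 0 < min r r₁ := lt_min hr hr₁
  have key : ∀ {p q : ℝ × ℝ}, p ∈ T → q ∈ T → InvOn A box (push h f γ H p.1 p.2) →
      InvOn A box (push h f γ H q.1 q.2) := fun {p q} hp hq hinv => by
    refine InvOn.of_preconnected isCompact_box hTc (F := fun p => push h f γ H p.1 p.2)
      (fun p _ => D.push_mem hHA _ _) ?_ (fun p hp => ?_) hp hq hinv
    · exact (D.continuous_push.comp (f := fun p : (ℝ × ℝ) × ℝ × ℝ => ((p.1, H p.2), p.2))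
        (by fun_prop)).continuousOn
    · have h1 : |p.1 - σ₀| < min r r₁ := by
        rw [← Real.dist_eq]; exact hp.1.2
      exact hne p.1 hp.1.1 (h1.trans_le (min_le_right _ _)) p.2 hp.2.1 hp.2.2 H hC
        (hH p.1 (h1.trans_le (min_le_left _ _)))
  have key2 : ∀ {σ σ' : ℝ}, σ ∈ Icc (-(R + 1)) (R + 1) ∩ Metric.ball σ₀ (min r r₁) →
      σ' ∈ Icc (-(R + 1)) (R + 1) ∩ Metric.ball σ₀ (min r r₁) →
      PushInv h A f γ H σ → PushInv h A f γ H σ' := fun {σ σ'} hσ hσ' ⟨τ₀, hτ₀, hinv⟩ => by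
    refine ⟨r₁, hr₁, fun τ hτ hτr => ?_⟩
    set τ₁ := min τ₀ r₁ / 2 with hτ₁
    have hpos : 0 < min τ₀ r₁ := lt_min hτ₀ hr₁
    have h1 : τ₁ < τ₀ := by linarith [min_le_left τ₀ r₁]
    have h2 : τ₁ < r₁ := by linarith [min_le_right τ₀ r₁]
    exact key (p := (σ, τ₁)) (q := (σ', τ)) ⟨hσ, half_pos hpos, h2⟩ ⟨hσ', hτ, hτr⟩
      (hinv τ₁ (half_pos hpos) h1)
  refine ⟨min r r₁, hrr, fun σ hσ hσσ => ?_⟩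
  have hm : σ ∈ Metric.ball σ₀ (min r r₁) := by rwa [Metric.mem_ball, Real.dist_eq]
  exact ⟨key2 ⟨hσ, hm⟩ ⟨hσ₀, Metric.mem_ball_self hrr⟩,
    key2 ⟨hσ₀, Metric.mem_ball_self hrr⟩ ⟨hσ, hm⟩⟩

theorem pushInv_of_segment (D : CurveDisc h A f ψ g γ R ε) {σ : ℝ}
    (hσ : σ ∈ Icc (-(R + 1)) (R + 1)) {H H' : ℝ × ℝ → ℂ} (hHA : H ∈ A) (hHc : Continuous H)
    (hHA' : H' ∈ A) (hHc' : Continuous H') {δ : ℝ} (hδ : 0 < δ)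
    (hHH' : ∀ s ∈ Icc (0 : ℝ) 1, NearSign f γ (fun x => (1 - s) * H x + s * H' x) σ δ)
    (hinv : PushInv h A f γ H σ) : PushInv h A f γ H' σ := by
  obtain ⟨C, hC⟩ := exists_norm_le hHc
  obtain ⟨C', hC'⟩ := exists_norm_le hHc'
  obtain ⟨r, hr, hne⟩ := D.push_ne_zero hσ (C := C + C') hδ
  obtain ⟨τ₀, hτ₀, hinv⟩ := hinv
  refine ⟨min τ₀ r, lt_min hτ₀ hr, fun τ hτ hτr => ?_⟩
  have h1 := InvOn.of_preconnected isCompact_box (convex_Icc (0 : ℝ) 1).isPreconnected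
    (F := fun s => push h f γ (fun x => (1 - s) * H x + s * H' x) σ τ) (A := A)
    (fun s _ => D.push_mem (add_mem (mul_mem (A.algebraMap_mem (1 - s)) hHA)
      (mul_mem (A.algebraMap_mem s) hHA')) _ _)
    (D.continuous_push.comp (f := fun p : ℝ × ℝ × ℝ =>
      (((σ, τ), (1 - p.1) * H p.2 + p.1 * H' p.2), p.2)) (by fun_prop)).continuousOn
    (fun s hs => ?_) (left_mem_Icc.2 zero_le_one) (right_mem_Icc.2 zero_le_one) ?_
  · simpa using h1
  · refine hne σ hσ (by simpa using hr) τ hτ (hτr.trans_le (min_le_right _ _)) _ (fun x hx => ?_)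
      (hHH' s hs)
    have h2 : ‖((1 - s : ℝ) : ℂ) * H x‖ ≤ C := by
      rw [norm_mul, Complex.norm_real, Real.norm_eq_abs, abs_of_nonneg (by linarith [hs.2])]
      exact (mul_le_of_le_one_left (norm_nonneg _) (by linarith [hs.1])).trans (hC x hx)
    have h3 : ‖(s : ℂ) * H' x‖ ≤ C' := by
      rw [norm_mul, Complex.norm_real, Real.norm_eq_abs, abs_of_nonneg hs.1]
      exact (mul_le_of_le_one_left (norm_nonneg _) hs.2).trans (hC' x hx)
    push_cast at h2
    exact (norm_add_le _ _).trans (add_le_add h2 h3)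
  · simpa using hinv τ hτ (hτr.trans_le (min_le_left _ _))

theorem pushInv_of_splits (D : CurveDisc h A f ψ g γ R ε) {σ : ℝ}
    (hσ : σ ∈ Icc (-(R + 1)) (R + 1)) {H H' : ℝ × ℝ → ℂ} (hHA : H ∈ A) (hHc : Continuous H)
    (hHA' : H' ∈ A) (hHc' : Continuous H') {δ δ' : ℝ} (hδ : 0 < δ) (hδ' : 0 < δ')
    (hH : Splits f g γ ε H σ δ) (hH' : Splits f g γ ε H' σ δ')
    (hinv : PushInv h A f γ H σ) : PushInv h A f γ H' σ :=
  D.pushInv_of_segment hσ hHA hHc hHA' hHc' (lt_min hδ hδ') (fun _ hs => Splits.nearSign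
    (Splits.segment (fun x hx hfx => hH x hx (hfx.trans_le (min_le_left _ _)))
      (fun x hx hfx => hH' x hx (hfx.trans_le (min_le_right _ _))) hs)) hinv

end CurveDisc

theorem polynomial_comp_mem {E : Type*} {A : Subalgebra ℂ (E → ℂ)} {ψ : E → ℂ} (hψ : ψ ∈ A)
    (p : Polynomial ℂ) : (fun x => p.eval (ψ x)) ∈ A := by
  induction p using Polynomial.induction_on' with
  | add p q hp hq =>
    simp only [Polynomial.eval_add]
    exact add_mem hp hq
  | monomial n a =>
    simp only [Polynomial.eval_monomial]
    exact mul_mem (A.algebraMap_mem a) (pow_mem hψ n)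

/-- The fibre of the disc over a point of the curve. -/
def fibre (f : ℝ × ℝ → ℂ) (z : ℂ) : Set (ℝ × ℝ) := box ∩ f ⁻¹' {z}

/-- The status of `f - c` for `c` near a regular zero of `k` is constant on `{k > 0}`. -/
theorem eventually_invOn_iff_of_pos {k : ℂ → ℝ} (hk : ContDiff ℝ (⊤ : ℕ∞) k)
    {A : Subalgebra ℂ (ℝ × ℝ → ℂ)} {f : ℝ × ℝ → ℂ} (hf : Continuous f) (hfA : f ∈ A)
    (hkf : ∀ x ∈ box, k (f x) = 0) {z : ℂ} (hz : k z = 0) (h0 : grad k z ≠ 0) :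
    ∀ᶠ c in 𝓝 z, 0 < k c → (InvOn A box (fun x => f x - c) ↔
      ∃ τ₀ > 0, ∀ τ : ℝ, 0 < τ → τ < τ₀ → InvOn A box (fun x => f x - (z + τ * grad k z))) := by
  set n := grad k z with hn
  set m := ‖n‖ with hm
  have hm0 : 0 < m := norm_pos_iff.2 h0
  have hs := (hk.contDiffAt (x := z)).hasStrictFDerivAt (by simp)
  obtain ⟨r, hr, hball⟩ := Metric.eventually_nhds_iff_ball.1
    (hs.isLittleO.def (c := m / 4) (by positivity))
  have hball' : ∀ a b, ‖a - z‖ < r → ‖b - z‖ < r →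
      |k a - k b - fderiv ℝ k z (a - b)| ≤ m / 4 * ‖a - b‖ := fun a b ha hb =>
    hball (a, b) (by rw [← ball_prod_same]; exact ⟨mem_ball_iff_norm.2 ha, mem_ball_iff_norm.2 hb⟩)
  have hnorm : ∀ t : ℝ, 0 ≤ t → ‖(t : ℂ) * n‖ = t * m := fun t ht => by
    rw [norm_mul, Complex.norm_real, Real.norm_eq_abs, abs_of_nonneg ht]
  have hinc : ∀ c, ‖c - z‖ < r / 2 → ∀ t : ℝ, 0 ≤ t → t * m < r / 2 →
      k c + t * (1 / 2 * m ^ 2) ≤ k (c + t * n) := fun c hc t ht htr => by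
    have h1 := hball' (c + t * n) c (by
      rw [show c + t * n - z = (c - z) + t * n by ring]
      refine (norm_add_le _ _).trans_lt ?_
      rw [hnorm t ht]
      linarith) (by linarith)
    rw [add_sub_cancel_left, hnorm t ht, fderiv_eq_grad, ← hn] at h1
    have h2 : ((starRingEnd ℂ) n * (t * n)).re = t * m ^ 2 := by
      rw [show (starRingEnd ℂ) n * (t * n) = t * ((starRingEnd ℂ) n * n) by ring,
        Complex.conj_mul', ← hm]
      norm_cast
    have h3 : n.re * (t * n).re + n.im * (t * n).im = t * m ^ 2 := by
      rw [← h2, Complex.mul_re ((starRingEnd ℂ) n), Complex.conj_re, Complex.conj_im]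
      ring
    rw [h3] at h1
    have := (abs_le.1 h1).1
    nlinarith [mul_nonneg ht (sq_nonneg m)]
  have hseg : ∀ a b, (∀ c ∈ segment ℝ a b, 0 < k c) →
      (InvOn A box (fun x => f x - a) ↔ InvOn A box (fun x => f x - b)) := fun a b hab =>
    invOn_sub_const_iff isCompact_box hf.continuousOn hfA (convex_segment a b).isPreconnected
      (disjoint_left.2 fun c hc ⟨x, hx, hxc⟩ => by
        have := hab c hc
        rw [← hxc, hkf x hx] at this
        exact lt_irrefl _ this) (left_mem_segment ℝ a b) (right_mem_segment ℝ a b)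
  have hup : ∀ c, ‖c - z‖ < r / 2 → ∀ s t : ℝ, 0 ≤ s → s ≤ t → t * m < r / 2 →
      0 < k c + s * (1 / 2 * m ^ 2) → (InvOn A box (fun x => f x - (c + s * n)) ↔
        InvOn A box (fun x => f x - (c + t * n))) := fun c hc s t hs hst ht hpos => by
    refine hseg _ _ fun d hd => ?_
    rw [segment_eq_image'] at hd
    obtain ⟨θ, hθ, rfl⟩ := hd
    have h1 : s ≤ s + θ * (t - s) := by nlinarith [hθ.1]
    have h2 : s + θ * (t - s) ≤ t := by nlinarith [hθ.2]
    have h3 := hinc c hc (s + θ * (t - s)) (hs.trans h1)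
      ((mul_le_mul_of_nonneg_right h2 hm0.le).trans_lt ht)
    have h4 : c + s * n + θ • (c + t * n - (c + s * n)) = c + ((s + θ * (t - s) : ℝ) : ℂ) * n := by
      simp only [Complex.real_smul]
      push_cast
      ring
    simp only [h4]
    have : s * (1 / 2 * m ^ 2) ≤ (s + θ * (t - s)) * (1 / 2 * m ^ 2) := by gcongr
    linarith
  set T := r / (4 * m) with hT
  have hT0 : 0 < T := by positivity
  have hTm : T * m < r / 2 := by
    rw [hT]; field_simp; norm_num
  have hzz : ‖z - z‖ < r / 2 := by simpa using hr
  have hpush : InvOn A box (fun x => f x - (z + T * n)) ↔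
      ∃ τ₀ > 0, ∀ τ : ℝ, 0 < τ → τ < τ₀ → InvOn A box (fun x => f x - (z + τ * n)) := by
    have h1 : ∀ τ, 0 < τ → τ ≤ T → (InvOn A box (fun x => f x - (z + τ * n)) ↔
        InvOn A box (fun x => f x - (z + T * n))) := fun τ hτ hτT =>
      hup z hzz τ T hτ.le hτT hTm (by rw [hz, zero_add]; positivity)
    constructor
    · exact fun hi => ⟨T, hT0, fun τ hτ hτT => (h1 τ hτ hτT.le).2 hi⟩
    · rintro ⟨τ₀, hτ₀, hi⟩
      have h2 : 0 < min τ₀ T := lt_min hτ₀ hT0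
      exact (h1 _ (half_pos h2) (by linarith [min_le_right τ₀ T])).1
        (hi _ (half_pos h2) (by linarith [min_le_left τ₀ T]))
  have hlow : ∀ᶠ d in 𝓝 z, 0 < k (d + T * n) := by
    have hc : ContinuousAt (fun d : ℂ => k (d + T * n)) z :=
      (hk.continuous.comp (continuous_id.add continuous_const)).continuousAt
    refine hc.eventually_const_lt ?_
    have := hinc z hzz T hT0.le hTm
    rw [hz, zero_add] at this
    exact lt_of_lt_of_le (by positivity) this
  obtain ⟨ρ, hρ, hρb⟩ := Metric.eventually_nhds_iff_ball.1 hlow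
  filter_upwards [Metric.ball_mem_nhds z hρ, Metric.ball_mem_nhds z (half_pos hr)]
    with c hcρ hcr hpos
  have h1 := hup c (mem_ball_iff_norm.1 hcr) 0 T le_rfl hT0.le hTm (by simpa using hpos)
  simp only [Complex.ofReal_zero, zero_mul, add_zero] at h1
  rw [h1, ← hpush]
  refine hseg _ _ fun d hd => ?_
  have h2 : d - T * n ∈ segment ℝ c z := by
    rw [segment_eq_image'] at hd ⊢
    obtain ⟨θ, hθ, rfl⟩ := hd
    exact ⟨θ, hθ, by simp only [Complex.real_smul]; ring⟩
  have h3 := hρb _ ((convex_ball z ρ).segment_subset hcρ (Metric.mem_ball_self hρ) h2)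
  rwa [sub_add_cancel] at h3

namespace CurveDisc

variable {h : ℂ → ℝ} {A : Subalgebra ℂ (ℝ × ℝ → ℂ)} {f ψ : ℝ × ℝ → ℂ} {g : ℝ × ℝ → ℝ}
  {γ : ℝ → ℂ} {R ε : ℝ}

theorem isCompact_fibre (D : CurveDisc h A f ψ g γ R ε) (z : ℂ) : IsCompact (fibre f z) :=
  isCompact_box.inter_right (isClosed_singleton.preimage D.f_cont)

theorem invOn_fibre (D : CurveDisc h A f ψ g γ R ε) {z c : ℂ} (hc : c ∉ ψ '' fibre f z) :
    InvOn polyAlg (ψ '' fibre f z) (fun w => w - c) := by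
  refine DiscConvex.invOn_fibre D.g_diff D.ψ_diff (D.isCompact_fibre z) inter_subset_left
    (fun x hx y hy hxy => D.inj x hx.1 y hy.1 (hx.2.trans hy.2.symm) hxy) (fun x hx => ?_)
    D.dg_ne D.tr hc
  have hev : ∀ᶠ y in 𝓝 x, |g y - g x| < ε := by
    have hgc := D.g_diff.continuous
    have hc : ContinuousAt (fun y => |g y - g x|) x := by fun_prop
    exact hc.eventually_lt_const (by simpa using D.ε_pos)
  filter_upwards [hev] with y hy hyS
  by_contra hne
  refine D.γ_inj _ (D.g_mem hyS.1) _ (D.g_mem hx.1) hne hy ?_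
  rw [← D.lift y hyS.1, ← D.lift x hx.1]
  exact hyS.2.trans hx.2.symm

theorem exists_splits (D : CurveDisc h A f ψ g γ R ε) {σ₀ : ℝ}
    (hσ₀ : σ₀ ∈ Icc (-(R + 1)) (R + 1)) :
    ∃ H ∈ A, Continuous H ∧ ∃ δ > 0, ∃ r > 0, ∀ σ, |σ - σ₀| < r → Splits f g γ ε H σ δ := by
  have hgc := D.g_diff.continuous
  have hψc := D.ψ_diff.continuous
  have hfc := D.f_cont
  have hγc := D.γ_cont
  set S := fibre f (γ σ₀) with hS
  have hne : ∀ x ∈ S, g x ≠ σ₀ - ε / 2 := fun x hx hgx => by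
    refine D.γ_inj σ₀ hσ₀ _ (D.g_mem hx.1) (by rw [hgx]; linarith [D.ε_pos]) ?_ ?_
    · rw [hgx, abs_lt]
      constructor <;> linarith [D.ε_pos]
    · rw [← D.lift x hx.1]
      exact hx.2.symm
  have hSc := D.isCompact_fibre (γ σ₀)
  have hunion : ψ '' (S ∩ {x | σ₀ - ε / 2 ≤ g x}) ∪ ψ '' (S ∩ {x | g x ≤ σ₀ - ε / 2}) =
      ψ '' S := by
    rw [← image_union, ← inter_union_distrib_left]
    congr 1
    exact inter_eq_left.2 fun x _ => le_total (σ₀ - ε / 2) (g x)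
  obtain ⟨p, hp₁, hp₂⟩ := exists_polynomial_separating (ε := 1 / 16)
    (L₁ := ψ '' (S ∩ {x | σ₀ - ε / 2 ≤ g x})) (L₂ := ψ '' (S ∩ {x | g x ≤ σ₀ - ε / 2}))
    ((hSc.inter_right (isClosed_le continuous_const hgc)).image hψc)
    ((hSc.inter_right (isClosed_le hgc continuous_const)).image hψc)
    (disjoint_left.2 (by
      rintro _ ⟨x, hx, rfl⟩ ⟨y, hy, hxy⟩
      have : x = y := D.inj x hx.1.1 y hy.1.1 (hx.1.2.trans hy.1.2.symm) hxy.symm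
      subst this
      exact hne x hx.1 (le_antisymm hy.2 hx.2)))
    (by
      rw [hunion]
      exact fun c hc => D.invOn_fibre hc) (by norm_num)
  set H : ℝ × ℝ → ℂ := fun x => 2 * p.eval (ψ x) - 1 with hH
  have hHc : Continuous H := (continuous_const.mul (p.continuous.comp hψc)).sub continuous_const
  have hev : ∀ᶠ q : ℝ × ℝ in 𝓝 (σ₀, 0), ∀ x ∈ box, ‖f x - γ q.1‖ < q.2 →
      (q.1 - ε / 2 ≤ g x → ‖H x - 1‖ < 1 / 4) ∧ (g x ≤ q.1 - ε / 2 → ‖H x + 1‖ < 1 / 4) := by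
    refine isCompact_box.eventually_forall_of_forall_eventually fun y hy => ?_
    by_cases hyS : f y = γ σ₀
    · have hyS' : y ∈ S := ⟨hy, hyS⟩
      rcases lt_or_gt_of_ne (hne y hyS') with hlt | hlt
      · have h1 : ‖H y + 1‖ < 1 / 4 := by
          have := hp₂ (ψ y) ⟨y, ⟨hyS', hlt.le⟩, rfl⟩
          rw [hH, show 2 * p.eval (ψ y) - 1 + 1 = 2 * p.eval (ψ y) by ring, norm_mul]
          norm_num
          linarith
        have e1 : ∀ᶠ q : (ℝ × ℝ) × ℝ × ℝ in 𝓝 ((σ₀, 0), y), ‖H q.2 + 1‖ < 1 / 4 :=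
          (show ContinuousAt (fun q : (ℝ × ℝ) × ℝ × ℝ => ‖H q.2 + 1‖) ((σ₀, 0), y) by
            fun_prop).eventually_lt_const h1
        have e2 : ∀ᶠ q : (ℝ × ℝ) × ℝ × ℝ in 𝓝 ((σ₀, 0), y), g q.2 - (q.1.1 - ε / 2) < 0 :=
          (show ContinuousAt (fun q : (ℝ × ℝ) × ℝ × ℝ => g q.2 - (q.1.1 - ε / 2)) ((σ₀, 0), y) by
            fun_prop).eventually_lt_const (by simpa using hlt)
        filter_upwards [e1, e2] with q hq1 hq2 _
        exact ⟨fun h => absurd h (by linarith), fun _ => hq1⟩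
      · have h1 : ‖H y - 1‖ < 1 / 4 := by
          have := hp₁ (ψ y) ⟨y, ⟨hyS', hlt.le⟩, rfl⟩
          rw [hH, show 2 * p.eval (ψ y) - 1 - 1 = 2 * (p.eval (ψ y) - 1) by ring, norm_mul]
          norm_num
          linarith
        have e1 : ∀ᶠ q : (ℝ × ℝ) × ℝ × ℝ in 𝓝 ((σ₀, 0), y), ‖H q.2 - 1‖ < 1 / 4 :=
          (show ContinuousAt (fun q : (ℝ × ℝ) × ℝ × ℝ => ‖H q.2 - 1‖) ((σ₀, 0), y) by
            fun_prop).eventually_lt_const h1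
        have e2 : ∀ᶠ q : (ℝ × ℝ) × ℝ × ℝ in 𝓝 ((σ₀, 0), y), 0 < g q.2 - (q.1.1 - ε / 2) :=
          (show ContinuousAt (fun q : (ℝ × ℝ) × ℝ × ℝ => g q.2 - (q.1.1 - ε / 2)) ((σ₀, 0), y) by
            fun_prop).eventually_const_lt (by simpa using hlt)
        filter_upwards [e1, e2] with q hq1 hq2 _
        exact ⟨fun _ => hq1, fun h => absurd h (by linarith)⟩
    · have e1 : ∀ᶠ q : (ℝ × ℝ) × ℝ × ℝ in 𝓝 ((σ₀, 0), y), 0 < ‖f q.2 - γ q.1.1‖ - q.1.2 :=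
        (show ContinuousAt (fun q : (ℝ × ℝ) × ℝ × ℝ => ‖f q.2 - γ q.1.1‖ - q.1.2) ((σ₀, 0), y) by
          fun_prop).eventually_const_lt (by simpa [sub_eq_zero] using hyS)
      filter_upwards [e1] with q hq1 hq2
      exact absurd hq2 (by linarith)
  obtain ⟨r, hr, hball⟩ := Metric.eventually_nhds_iff_ball.1 hev
  refine ⟨H, sub_mem (mul_mem (A.algebraMap_mem 2) (polynomial_comp_mem D.ψ_mem p)) (one_mem A),
    hHc, r / 2, half_pos hr, r, hr, fun σ hσ => ?_⟩
  refine hball (σ, r / 2) ?_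
  rw [← ball_prod_same]
  exact ⟨by rwa [Metric.mem_ball, Real.dist_eq], by
    rw [Metric.mem_ball, Real.dist_eq, sub_zero, abs_of_pos (half_pos hr)]; linarith⟩

theorem pushInv_one_iff_pushInv_neg_one_of_ends (D : CurveDisc h A f ψ g γ R ε) :
    PushInv h A f γ 1 (-R) ↔ PushInv h A f γ (-1) (R + 3 * ε / 4) := by
  have hε := D.ε_pos
  have hε1 := D.ε_le
  have hR := D.R_pos
  set Good : ℝ → Prop := fun σ => ∃ H ∈ A, Continuous H ∧ ∃ δ > 0, Splits f g γ ε H σ δ ∧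
    PushInv h A f γ H σ with hGood
  have good_iff : ∀ {σ}, σ ∈ Icc (-(R + 1)) (R + 1) → ∀ {H}, H ∈ A → Continuous H → ∀ {δ}, 0 < δ →
      Splits f g γ ε H σ δ → (Good σ ↔ PushInv h A f γ H σ) := fun hσ H hHA hHc δ hδ hH =>
    ⟨fun ⟨_, hHA', hHc', _, hδ', hH', hinv⟩ =>
      D.pushInv_of_splits hσ hHA' hHc' hHA hHc hδ' hδ hH' hH hinv,
      fun hinv => ⟨H, hHA, hHc, δ, hδ, hH, hinv⟩⟩
  have hmem : Icc (-R) (R + 3 * ε / 4) ⊆ Icc (-(R + 1)) (R + 1) :=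
    Icc_subset_Icc (by linarith) (by linarith)
  have h1 : Good (-R) ↔ PushInv h A f γ 1 (-R) := by
    refine good_iff (hmem (left_mem_Icc.2 (by linarith))) (one_mem A) continuous_one one_pos
      fun x hx _ => ⟨fun _ => by norm_num, fun hg => ?_⟩
    have := (abs_le.1 (D.g_le x hx)).1
    exact absurd hg (by linarith)
  have h2 : Good (R + 3 * ε / 4) ↔ PushInv h A f γ (-1) (R + 3 * ε / 4) := by
    refine good_iff (hmem (right_mem_Icc.2 (by linarith))) (neg_mem (one_mem A))
      continuous_one.neg one_pos fun x hx _ => ⟨fun hg => ?_, fun _ => by norm_num⟩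
    have := (abs_le.1 (D.g_le x hx)).2
    exact absurd hg (by linarith)
  rw [← h1, ← h2]
  refine iff_of_locally_iff (isPreconnected_Icc (a := -R) (b := R + 3 * ε / 4))
    (fun σ₀ hσ₀ => ?_) (left_mem_Icc.2 (by linarith)) (right_mem_Icc.2 (by linarith))
  obtain ⟨H, hHA, hHc, δ, hδ, r, hr, hH⟩ := D.exists_splits (hmem hσ₀)
  obtain ⟨r', hr', hloc⟩ := D.pushInv_iff_of_near (hmem hσ₀) hHA hHc hδ hr
    fun σ hσ => (hH σ hσ).nearSign
  rw [eventually_nhdsWithin_iff]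
  filter_upwards [Metric.ball_mem_nhds σ₀ (lt_min hr hr')] with σ hσ hσI
  rw [Metric.mem_ball, Real.dist_eq] at hσ
  rw [good_iff (hmem hσI) hHA hHc hδ (hH σ (hσ.trans_le (min_le_left _ _))),
    good_iff (hmem hσ₀) hHA hHc hδ (hH σ₀ (by simpa using hr))]
  exact hloc σ (hmem hσI) (hσ.trans_le (min_le_right _ _))

theorem pushInv_iff_of_const (D : CurveDisc h A f ψ g γ R ε) {H : ℝ × ℝ → ℂ} (hHA : H ∈ A)
    (hHc : Continuous H) (hH : ∀ x, ‖H x - 1‖ < 1 / 4 ∨ ‖H x + 1‖ < 1 / 4) {σ σ' : ℝ}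
    (hσ : σ ∈ Icc (-(R + 1)) (R + 1)) (hσ' : σ' ∈ Icc (-(R + 1)) (R + 1)) :
    PushInv h A f γ H σ ↔ PushInv h A f γ H σ' := by
  refine iff_of_locally_iff (isPreconnected_Icc (a := -(R + 1)) (b := R + 1))
    (fun σ₀ hσ₀ => ?_) hσ hσ'
  obtain ⟨r', hr', hloc⟩ := D.pushInv_iff_of_near hσ₀ hHA hHc one_pos one_pos
    fun σ _ x _ _ => hH x
  rw [eventually_nhdsWithin_iff]
  filter_upwards [Metric.ball_mem_nhds σ₀ hr'] with σ hσ hσI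
  rw [Metric.mem_ball, Real.dist_eq] at hσ
  exact hloc σ hσI hσ

theorem pushInv_one_iff_pushInv_neg_one (D : CurveDisc h A f ψ g γ R ε) {σ : ℝ}
    (hσ : σ ∈ Icc (-(R + 1)) (R + 1)) : PushInv h A f γ 1 σ ↔ PushInv h A f γ (-1) σ := by
  have hε := D.ε_pos
  have hε1 := D.ε_le
  have hR := D.R_pos
  rw [D.pushInv_iff_of_const (one_mem A) continuous_one (fun x => Or.inl (by norm_num)) hσ
    (σ' := -R) ⟨by linarith, by linarith⟩,
    D.pushInv_iff_of_const (neg_mem (one_mem A)) continuous_one.neg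
      (fun x => Or.inr (by norm_num)) hσ (σ' := R + 3 * ε / 4) ⟨by linarith, by linarith⟩]
  exact D.pushInv_one_iff_pushInv_neg_one_of_ends

theorem eventually_invOn_iff (D : CurveDisc h A f ψ g γ R ε) {σ : ℝ}
    (hσ : σ ∈ Icc (-(R + 1)) (R + 1)) :
    ∀ᶠ c in 𝓝 (γ σ), h c ≠ 0 → (InvOn A box (fun x => f x - c) ↔ PushInv h A f γ 1 σ) := by
  have h1 := eventually_invOn_iff_of_pos D.hsm D.f_cont D.f_mem (fun x hx => D.h_eq_zero hx)
    (D.γ_zero σ hσ) (D.γ_reg σ hσ)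
  have hneg : grad (-h) (γ σ) = -grad h (γ σ) := by
    apply Complex.ext <;> simp [grad, fderiv_neg]
  have h2 := eventually_invOn_iff_of_pos (k := -h) (z := γ σ) D.hsm.neg D.f_cont D.f_mem
    (fun x hx => by simp [D.h_eq_zero hx]) (by simp [D.γ_zero σ hσ])
    (by rw [hneg]; exact neg_ne_zero.2 (D.γ_reg σ hσ))
  filter_upwards [h1, h2] with c hc1 hc2 hne
  rcases lt_or_gt_of_ne hne with hlt | hlt
  · rw [D.pushInv_one_iff_pushInv_neg_one hσ, hc2 (by simpa using hlt), PushInv, hneg]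
    have : ∀ τ : ℝ, push h f γ (-1) σ τ = fun x => f x - (γ σ + τ * -grad h (γ σ)) := fun τ => by
      funext x
      simp only [push, Pi.neg_apply, Pi.one_apply]
      ring
    simp only [this]
  · rw [hc1 hlt, PushInv]
    have : ∀ τ : ℝ, push h f γ 1 σ τ = fun x => f x - (γ σ + τ * grad h (γ σ)) := fun τ => by
      funext x
      simp only [push, Pi.one_apply]
      ring
    simp only [this]

theorem badSet_eq_empty (D : CurveDisc h A f ψ g γ R ε) : badSet A box f = ∅ := by
  by_contra hne
  obtain ⟨⟨z, hz⟩, hsub⟩ := frontier_closure_badSet isCompact_box D.f_cont.continuousOn D.f_mem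
    (nonempty_iff_ne_empty.2 hne)
  obtain ⟨x, hx, rfl⟩ := hsub hz
  rw [D.lift x hx] at hz
  have hσ := D.g_mem hx
  set W := badSet A box f with hW
  have hev : ∀ᶠ c in 𝓝 (γ (g x)), grad h c ≠ 0 ∧
      (h c ≠ 0 → (InvOn A box (fun x => f x - c) ↔ PushInv h A f γ 1 (g x))) :=
    ((contDiff_grad D.hsm).continuous.continuousAt.eventually_ne (D.γ_reg _ hσ)).and
      (D.eventually_invOn_iff hσ)
  obtain ⟨V, hVsub, hV, hzV⟩ := mem_nhds_iff.1 hev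
  have hpt : ∀ O : Set ℂ, IsOpen O → (O ∩ V).Nonempty → ∃ c ∈ O ∩ V, h c ≠ 0 :=
    fun O hO ⟨c, hc⟩ => by
      by_contra! hall
      have h1 : h =ᶠ[𝓝 c] fun _ => 0 := by
        filter_upwards [(hO.inter hV).mem_nhds hc] with d hd using hall d hd
      refine (hVsub hc.2).1 ?_
      apply Complex.ext <;> simp [grad, h1.fderiv_eq]
  rw [frontier, closure_closure, Set.mem_sdiff, mem_interior_iff_mem_nhds] at hz
  obtain ⟨c, hc, hc0⟩ := hpt W (isOpen_badSet isCompact_box D.f_cont.continuousOn D.f_mem).1 (by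
    rw [inter_comm]; exact mem_closure_iff.1 hz.1 V hV hzV)
  obtain ⟨d, hd, hd0⟩ := hpt (closure W)ᶜ isClosed_closure.isOpen_compl (by
    by_contra hemp
    refine hz.2 (mem_of_superset (hV.mem_nhds hzV) fun y hy => ?_)
    by_contra hyW
    exact hemp ⟨y, hyW, hy⟩)
  refine hc.1.2 (((hVsub hc.2).2 hc0).2 (((hVsub hd.2).2 hd0).1 ?_))
  by_contra hninv
  refine hd.1 (subset_closure ⟨?_, hninv⟩)
  rintro ⟨y, hy, rfl⟩
  exact hd0 (D.h_eq_zero hy)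

theorem invOn_sub_const (D : CurveDisc h A f ψ g γ R ε) {c : ℂ} (hc : c ∉ f '' box) :
    InvOn A box (fun x => f x - c) := by
  by_contra hninv
  exact (D.badSet_eq_empty ▸ notMem_empty c) ⟨hc, hninv⟩

theorem pushInv_one (D : CurveDisc h A f ψ g γ R ε) {σ : ℝ}
    (hσ : σ ∈ Icc (-(R + 1)) (R + 1)) : PushInv h A f γ 1 σ := by
  obtain ⟨r, hr, hne⟩ := D.push_ne_zero hσ (C := 1) one_pos
  refine ⟨r, hr, fun τ hτ hτr => ?_⟩
  have h1 := hne σ hσ (by simpa using hr) τ hτ hτr 1 (fun x _ => by simp)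
    (fun x _ _ => Or.inl (by norm_num))
  refine (D.invOn_sub_const (c := γ σ + τ * grad h (γ σ)) ?_).congr fun x _ => ?_
  · rintro ⟨x, hx, hfx⟩
    refine h1 x hx ?_
    rw [push, hfx]
    simp
  · simp only [push, Pi.one_apply]
    ring

/-- A point over the curve which is off the disc is separated from it by an invertible function
vanishing at that point. -/
theorem exists_invOn_sub_polynomial (D : CurveDisc h A f ψ g γ R ε) {z w₀ : ℂ} (hz : z ∈ f '' box)
    (hw₀ : w₀ ∉ ψ '' fibre f z) :
    ∃ (q : Polynomial ℂ) (a : ℂ), q.eval w₀ = 0 ∧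
      InvOn A box (fun x => f x - z - a * q.eval (ψ x)) := by
  obtain ⟨x₀, hx₀, rfl⟩ := hz
  set σ := g x₀ with hσ
  have hσJ : σ ∈ Icc (-(R + 1)) (R + 1) := D.g_mem hx₀
  have hfσ : f x₀ = γ σ := D.lift x₀ hx₀
  rw [hfσ] at hw₀ ⊢
  have hψc := D.ψ_diff.continuous
  have hfc := D.f_cont
  obtain ⟨S, hS, hSb⟩ := (D.invOn_fibre hw₀).exists_pow
    (mem_polyAlg.2 ⟨Polynomial.X - Polynomial.C w₀, by simp⟩) 3
  obtain ⟨r, hr⟩ := mem_polyAlg.1 hS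
  set q : Polynomial ℂ := (Polynomial.X - Polynomial.C w₀) * r with hq
  set H : ℝ × ℝ → ℂ := fun x => q.eval (ψ x) with hH
  have hHc : Continuous H := q.continuous.comp hψc
  have hev : ∀ᶠ δ : ℝ in 𝓝 0, ∀ x ∈ box, ‖f x - γ σ‖ < δ → ‖H x - 1‖ < 1 / 4 := by
    refine isCompact_box.eventually_forall_of_forall_eventually fun y hy => ?_
    by_cases hyS : f y = γ σ
    · have h1 : ‖H y - 1‖ < 1 / 4 := by
        have := hSb (ψ y) ⟨y, ⟨hy, hyS⟩, rfl⟩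
        rw [hr] at this
        simp only [hH, hq, Polynomial.eval_mul, Polynomial.eval_sub, Polynomial.eval_X,
          Polynomial.eval_C]
        exact this.trans_lt (by norm_num)
      have e1 : ∀ᶠ p : ℝ × ℝ × ℝ in 𝓝 (0, y), ‖H p.2 - 1‖ < 1 / 4 :=
        (show ContinuousAt (fun p : ℝ × ℝ × ℝ => ‖H p.2 - 1‖) (0, y) by
          fun_prop).eventually_lt_const h1
      filter_upwards [e1] with p hp _ using hp
    · have e1 : ∀ᶠ p : ℝ × ℝ × ℝ in 𝓝 (0, y), 0 < ‖f p.2 - γ σ‖ - p.1 :=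
        (show ContinuousAt (fun p : ℝ × ℝ × ℝ => ‖f p.2 - γ σ‖ - p.1) (0, y) by
          fun_prop).eventually_const_lt (by simpa [sub_eq_zero] using hyS)
      filter_upwards [e1] with p hp hp'
      exact absurd hp' (by linarith)
  obtain ⟨δ, hδH, hδ⟩ := ((hev.filter_mono nhdsWithin_le_nhds).and
    (self_mem_nhdsWithin (s := Ioi (0 : ℝ)))).exists
  obtain ⟨τ₀, hτ₀, hinv⟩ := D.pushInv_of_segment (H' := H) hσJ (one_mem A) continuous_one
    (polynomial_comp_mem D.ψ_mem q) hHc hδ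
    (fun s hs x hx hfx => Or.inl (norm_segment_lt (by norm_num) (hδH x hx hfx) hs))
    (D.pushInv_one hσJ)
  exact ⟨q, (τ₀ / 2 : ℝ) * grad h (γ σ), by simp [hq], hinv _ (half_pos hτ₀) (by linarith)⟩

end CurveDisc

/-- The functions on `E` that are polynomials in the components of `Φ`. -/
def pullbackAlg {E : Type*} {n : ℕ} (Φ : E → Fin n → ℂ) : Subalgebra ℂ (E → ℂ) :=
  (MvPolynomial.aeval fun (i : Fin n) (x : E) => Φ x i).range

theorem mem_pullbackAlg {E : Type*} {n : ℕ} {Φ : E → Fin n → ℂ} {F : E → ℂ} :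
    F ∈ pullbackAlg Φ ↔ ∃ P : MvPolynomial (Fin n) ℂ, ∀ x, F x = MvPolynomial.eval (Φ x) P := by
  have h : ∀ (P : MvPolynomial (Fin n) ℂ) (x : E),
      MvPolynomial.aeval (fun (i : Fin n) (x : E) => Φ x i) P x = MvPolynomial.eval (Φ x) P :=
    fun P x => by
      induction P using MvPolynomial.induction_on with
      | C a => simp
      | add P Q hP hQ => simp [hP, hQ]
      | mul_X P i hP => simp [hP]
  constructor
  · rintro ⟨P, rfl⟩
    exact ⟨P, fun x => h P x⟩
  · rintro ⟨P, hP⟩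
    exact ⟨P, funext fun x => (h P x).trans (hP x).symm⟩

/-- A polynomial which is invertible on a set has no zeros on its polynomial hull. -/
theorem eval_ne_zero_of_mem_polyHull {E : Type*} {n : ℕ} {Φ : E → Fin n → ℂ} {K : Set E}
    (hK : K.Nonempty) {z : Fin n → ℂ} (hz : z ∈ polyHull n (Φ '' K))
    {P : MvPolynomial (Fin n) ℂ} (hP : InvOn (pullbackAlg Φ) K fun x => MvPolynomial.eval (Φ x) P) :
    MvPolynomial.eval z P ≠ 0 := by
  intro h0
  obtain ⟨S, hS, hb⟩ := hP
  obtain ⟨Q, hQ⟩ := mem_pullbackAlg.1 hS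
  have h1 := hz (P * Q - 1)
  have h2 : sSup ((fun w => ‖MvPolynomial.eval w (P * Q - 1)‖) '' (Φ '' K)) ≤ 1 / 2 := by
    refine csSup_le ((hK.image _).image _) ?_
    rintro _ ⟨_, ⟨x, hx, rfl⟩, rfl⟩
    have := hb x hx
    rw [hQ] at this
    simpa using this.le
  have h3 : ‖MvPolynomial.eval z (P * Q - 1)‖ = 1 := by simp [h0]
  linarith

theorem subset_polyHull {n : ℕ} {K : Set (Fin n → ℂ)} (hK : IsCompact K) : K ⊆ polyHull n K :=
  fun _ hz p => le_csSup (hK.image (MvPolynomial.continuous_eval p).norm).bddAbove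
    (mem_image_of_mem _ hz)

theorem CurveDisc.polyHull_subset {h : ℂ → ℝ} {Φ : ℝ × ℝ → Fin 2 → ℂ} {g : ℝ × ℝ → ℝ} {γ : ℝ → ℂ}
    {R ε : ℝ} (D : CurveDisc h (pullbackAlg Φ) (fun x => Φ x 0) (fun x => Φ x 1) g γ R ε) :
    polyHull 2 (Φ '' box) ⊆ Φ '' box := by
  intro z hz
  have hbox : box.Nonempty := ⟨0, Metric.mem_closedBall_self zero_le_one⟩
  have h0 : z 0 ∈ (fun x => Φ x 0) '' box := by
    by_contra hz0
    refine eval_ne_zero_of_mem_polyHull hbox hz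
      (P := MvPolynomial.X 0 - MvPolynomial.C (z 0)) ?_ (by simp)
    simpa using D.invOn_sub_const hz0
  have h1 : z 1 ∈ (fun x => Φ x 1) '' fibre (fun x => Φ x 0) (z 0) := by
    by_contra hz1
    obtain ⟨q, a, hq, hinv⟩ := D.exists_invOn_sub_polynomial h0 hz1
    have hev : ∀ v : Fin 2 → ℂ, MvPolynomial.eval v
        (Polynomial.aeval (MvPolynomial.X 1 : MvPolynomial (Fin 2) ℂ) q) = q.eval (v 1) :=
      fun v => by
        rw [← MvPolynomial.coe_aeval_eq_eval, RingHom.coe_coe, ← Polynomial.aeval_algHom_apply,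
          MvPolynomial.aeval_X, Polynomial.coe_aeval_eq_eval]
    refine eval_ne_zero_of_mem_polyHull hbox hz
      (P := MvPolynomial.X 0 - MvPolynomial.C (z 0) - MvPolynomial.C a *
        Polynomial.aeval (MvPolynomial.X 1 : MvPolynomial (Fin 2) ℂ) q) ?_ (by simp [hev, hq])
    simpa [hev] using hinv
  obtain ⟨x, hx, hx1⟩ := h1
  refine ⟨x, hx.1, funext fun i => ?_⟩
  fin_cases i
  · exact hx.2
  · exact hx1

/-- At a totally real point of a surface in `ℂ²` no coordinate has vanishing differential. -/
theorem apply_zero_ne_zero_of_totallyReal {L : ℝ × ℝ →L[ℝ] Fin 2 → ℂ} (hL : Function.Injective L)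
    (htr : ∀ v w, L v = Complex.I • L w → L v = 0) : ∃ v, L v 0 ≠ 0 := by
  by_contra! h
  set M : ℝ × ℝ →ₗ[ℝ] ℂ := (LinearMap.proj 1).comp L.toLinearMap with hM
  have hinj : Function.Injective M := (injective_iff_map_eq_zero M).2 fun v hv => by
    refine (injective_iff_map_eq_zero L).1 hL v (funext fun i => ?_)
    fin_cases i
    · exact h v
    · exact hv
  have hsurj : Function.Surjective M :=
    (LinearMap.injective_iff_surjective_of_finrank_eq_finrank (by simp)).1 hinj
  obtain ⟨w, hw⟩ := hsurj 1
  obtain ⟨v, hv⟩ := hsurj Complex.I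
  have hv' : L v 1 = Complex.I := hv
  have hw' : L w 1 = 1 := hw
  have := htr v w (funext fun i => by
    fin_cases i
    · simp [h]
    · simp [hv', hw'])
  rw [this] at hv'
  exact Complex.I_ne_zero hv'.symm

theorem polyConvex_image_box {h : ℂ → ℝ} (hsm : ContDiff ℝ (⊤ : ℕ∞) h)
    {Φ : ℝ × ℝ → Fin 2 → ℂ} (hΦ : ContDiff ℝ 2 Φ) (hinj : InjOn Φ box)
    (himm : ∀ x ∈ box, Function.Injective (fderiv ℝ Φ x))
    (htr : ∀ x ∈ box, ∀ v w, fderiv ℝ Φ x v = Complex.I • fderiv ℝ Φ x w → fderiv ℝ Φ x v = 0)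
    (hreg : ∀ x ∈ box, h (Φ x 0) = 0 ∧ fderiv ℝ h (Φ x 0) ≠ 0) :
    PolyConvex 2 (Φ '' box) := by
  have hcomp : ∀ i, ContDiff ℝ 2 fun x => Φ x i := fun i => contDiff_pi.1 hΦ i
  have hder : ∀ x i v, fderiv ℝ (fun x => Φ x i) x v = fderiv ℝ Φ x v i := fun x i v => by
    have hd : HasFDerivAt Φ (fderiv ℝ Φ x) x := (hΦ.differentiable (by simp) x).hasFDerivAt
    rw [((hasFDerivAt_pi'.1 hd) i).fderiv]
    rfl
  obtain ⟨g, γ, R, ε, hg, hR, hε, hε1, hgR, hγ, hγh, hγi, hlift, hdg, htr'⟩ :=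
    exists_lift (h := h) (f := fun x => Φ x 0) (ψ := fun x => Φ x 1) hsm (hcomp 0)
      (fun x hx => ⟨(hreg x hx).1, grad_ne_zero (hreg x hx).2⟩)
      (fun x hx u h0 h1 => by
        refine (injective_iff_map_eq_zero (fderiv ℝ Φ x)).1 (himm x hx) u (funext fun i => ?_)
        rw [hder] at h0 h1
        fin_cases i
        · exact h0
        · exact h1)
      (fun x hx h0 => by
        obtain ⟨v, hv⟩ := apply_zero_ne_zero_of_totallyReal (himm x hx) (htr x hx)
        rw [← hder, h0] at hv
        exact hv rfl)
  have hJ : -(R + 1) ≤ R + 1 := by linarith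
  have hext : ∀ t ∈ Icc (-(R + 1)) (R + 1), γ (projIcc _ _ hJ t) = γ t := fun t ht => by
    rw [projIcc_of_mem hJ ht]
  have hgJ : ∀ x ∈ box, g x ∈ Icc (-(R + 1)) (R + 1) := fun x hx => by
    have := abs_le.1 (hgR x hx)
    exact ⟨by linarith, by linarith⟩
  have D : CurveDisc h (pullbackAlg Φ) (fun x => Φ x 0) (fun x => Φ x 1) g
      (fun t => γ (projIcc _ _ hJ t)) R ε :=
    { hsm := hsm
      f_mem := mem_pullbackAlg.2 ⟨MvPolynomial.X 0, by simp⟩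
      ψ_mem := mem_pullbackAlg.2 ⟨MvPolynomial.X 1, by simp⟩
      f_cont := (hcomp 0).continuous
      ψ_diff := (hcomp 1).of_le one_le_two
      g_diff := hg
      γ_cont := (continuousOn_iff_continuous_domRestrict.1 hγ).comp continuous_projIcc
      ε_pos := hε
      ε_le := hε1
      R_pos := hR
      γ_zero := fun t ht => by rw [hext t ht]; exact (hγh t ht).1
      γ_reg := fun t ht => by rw [hext t ht]; exact (hγh t ht).2
      γ_inj := fun s hs t ht hst hlt => by
        rw [hext s hs, hext t ht]; exact hγi s hs t hst hlt
      lift := fun x hx => by rw [hext _ (hgJ x hx)]; exact hlift x hx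
      g_le := hgR
      inj := fun x hx y hy h0 h1 => hinj hx hy (funext fun i => by
        fin_cases i
        · exact h0
        · exact h1)
      dg_ne := hdg
      tr := htr' }
  exact Subset.antisymm D.polyHull_subset
    (subset_polyHull (isCompact_box.image hΦ.continuous))

end DiscConvex

/-- Let `h : ℂ → ℝ` be smooth, `E_h := {h = 0}`, and
`E*_h := {z : h z = 0, dh z ≠ 0}` its regular part. Then every totally real
`C²`-smooth disc contained in `E*_h × ℂ ⊆ ℂ²` is polynomially convex. -/
theorem totallyRealDisc_in_regular_curve_cross_C_polyConvex
    (h : ℂ → ℝ) (hsm : ContDiff ℝ (⊤ : ℕ∞) h)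
    (EhStar : Set ℂ) (hEhStar : EhStar = {z : ℂ | h z = 0 ∧ fderiv ℝ h z ≠ 0})
    (K : Set (Fin 2 → ℂ)) (hK : TotallyRealDisc 2 K)
    (hKM : K ⊆ {z : Fin 2 → ℂ | z 0 ∈ EhStar}) :
    PolyConvex 2 K := by
  subst hEhStar
  obtain ⟨U, φ, hU, hbU, hφ, hinj, himm, htr, rfl⟩ := hK
  obtain ⟨Φ, hΦ, -, hΦφ⟩ := DiscConvex.exists_contDiff_extension (n := 2)
    DiscConvex.isCompact_box hU hbU hφ
  have hloc : ∀ x ∈ DiscConvex.box, Φ =ᶠ[nhds x] φ := fun x hx =>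
    hΦφ.filter_mono (nhds_le_nhdsSet hx)
  have heq : Set.EqOn Φ φ DiscConvex.box := fun x hx => (hloc x hx).self_of_nhds
  rw [← heq.image_eq]
  refine DiscConvex.polyConvex_image_box hsm hΦ ((hinj.mono hbU).congr heq.symm)
    (fun x hx => ?_) (fun x hx => ?_) (fun x hx => ?_)
  · rw [(hloc x hx).fderiv_eq]
    exact himm x (hbU hx)
  · rw [(hloc x hx).fderiv_eq]
    exact htr x (hbU hx)
  · rw [heq hx]
    exact hKM ⟨x, hx, rfl⟩
end
end

section
/- Let h be a holomorphic function on an open set in ℂ² containing a real hypersurface M := { z : |h(z)|² − 1 = 0 }, and set ρ(z) := |h(z)|² − 1. Let γ : (a,b) → M be a C¹ curve such that for every t ∈ (a,b), both γ′(t) and iγ′(t) are orthogonal (in the standard real inner product on ℝ⁴ ≅ ℂ²) to the real gradient ∇ρ at γ(t) (equivalently, γ′(t) lies in the complex tangent space T_{γ(t)}^ℂ M). Then h ∘ γ is constant on (a,b). -/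
noncomputable section

/-- At a point where a complex differentiable function does not vanish, the differential of its
squared norm annihilates both `v` and `I • v` only if the complex differential annihilates `v`. -/
theorem fderiv_apply_eq_zero_of_fderiv_norm_sq {E : Type*} [NormedAddCommGroup E]
    [NormedSpace ℂ E] {h : E → ℂ} {p v : E} (hd : DifferentiableAt ℂ h p) (hp : h p ≠ 0)
    (hv : fderiv ℝ (fun z => ‖h z‖ ^ 2 - 1) p v = 0)
    (hIv : fderiv ℝ (fun z => ‖h z‖ ^ 2 - 1) p (Complex.I • v) = 0) :
    fderiv ℂ h p v = 0 := by
  have key := (hd.hasFDerivAt.restrictScalars ℝ).norm_sq.sub_const 1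
  rw [key.fderiv] at hv hIv
  simp [Complex.inner] at hv hIv
  have hsq : (h p).re ^ 2 + (h p).im ^ 2 ≠ 0 := by
    intro h0
    exact hp (Complex.ext (by simp; nlinarith) (by simp; nlinarith))
  apply Complex.ext
  · refine (mul_eq_zero.mp ?_).resolve_left hsq
    linear_combination (h p).re / 2 * hv + (h p).im / 2 * hIv
  · refine (mul_eq_zero.mp ?_).resolve_left hsq
    linear_combination (h p).im / 2 * hv - (h p).re / 2 * hIv

/-- Let `h` be holomorphic on an open set `V ⊆ ℂ²` containing
the hypersurface `M := {z ∈ V : |h z|² = 1}`, and set `ρ z := |h z|² - 1`.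
If `γ : (a,b) → M` is a `C¹` curve such that for every `t` both `γ'(t)` and
`i·γ'(t)` are annihilated by `dρ` at `γ(t)` (i.e. `γ'(t) ∈ T_{γ(t)}^ℂ M`,
equivalently both are orthogonal to the real gradient `∇ρ`), then `h ∘ γ` is
constant on `(a,b)`. -/
theorem holomorphic_constant_along_characteristic_leaf
    (V : Set (Fin 2 → ℂ)) (hV : IsOpen V)
    (h : (Fin 2 → ℂ) → ℂ) (hhol : DifferentiableOn ℂ h V)
    (M : Set (Fin 2 → ℂ)) (hM : M = {z ∈ V | ‖h z‖ ^ 2 = 1})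
    (ρ : (Fin 2 → ℂ) → ℝ) (hρ : ρ = fun z => ‖h z‖ ^ 2 - 1)
    (a b : ℝ) (γ γ' : ℝ → (Fin 2 → ℂ))
    (hγ : ∀ t ∈ Set.Ioo a b, HasDerivAt γ (γ' t) t)
    (hγ' : ContinuousOn γ' (Set.Ioo a b))
    (hγM : ∀ t ∈ Set.Ioo a b, γ t ∈ M)
    (horth : ∀ t ∈ Set.Ioo a b,
      fderiv ℝ ρ (γ t) (γ' t) = 0 ∧
      fderiv ℝ ρ (γ t) (Complex.I • γ' t) = 0) :
    ∀ s ∈ Set.Ioo a b, ∀ t ∈ Set.Ioo a b, h (γ s) = h (γ t) := by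
  subst hM hρ
  have hderiv : ∀ t ∈ Set.Ioo a b, HasDerivAt (h ∘ γ) 0 t := by
    intro t ht
    obtain ⟨hV_t, hnorm⟩ := hγM t ht
    have hd : DifferentiableAt ℂ h (γ t) := (hhol _ hV_t).differentiableAt (hV.mem_nhds hV_t)
    have hne : h (γ t) ≠ 0 := by
      intro h0
      simp [h0] at hnorm
    have hcomp := (hd.hasFDerivAt.restrictScalars ℝ).comp_hasDerivAt t (hγ t ht)
    have hzero := fderiv_apply_eq_zero_of_fderiv_norm_sq hd hne (horth t ht).1 (horth t ht).2
    simpa [hzero] using hcomp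
  intro s hs t ht
  exact isOpen_Ioo.is_const_of_deriv_eq_zero isPreconnected_Ioo
    (fun x hx => (hderiv x hx).differentiableAt.differentiableWithinAt)
    (fun x hx => (hderiv x hx).deriv) hs ht
end
end
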